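/- Let d = 4, let k ≥ 4 be an integer and F(s) = |s|^{k−1} s for s ∈ ℝ. For every ε ∈ (0, 1/2) there exists δ > 0 such that for every f : ℤ^4 → ℝ with ‖f‖_{l^1(ℤ^4)} ≤ δ there exists a function u : ℤ^4 × ℝ → ℝ satisfying the Duhamel integral equation u(·,t) = G(·,t)*f + ∫_0^t G(·,t−s) * F(u(·,s)) ds for all t ∈ ℝ (with discrete convolution in the space variable and F applied pointwise), and such that for every p ∈ [2, ∞] there exists C_p > 0 with ‖u(·,t)‖_{l^p(ℤ^4)} ≤ C_p (1+|t|)^{-(3/2 − ε)(1 − 2/p)} for all t ∈ ℝ. -/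

import Mathlib

open MeasureTheory Complex ENNReal

/-- `ω(ξ) = (∑ (2 - 2cos ξ_j))^{1/2}` -/
noncomputable def discOmega (d : ℕ) (ξ : Fin d → ℝ) : ℝ :=
  Real.sqrt (∑ j, (2 - 2 * Real.cos (ξ j)))

/-- the cube `[-π,π]^d` -/
def torusBox (d : ℕ) : Set (Fin d → ℝ) :=
  Set.univ.pi fun _ => Set.Icc (-Real.pi) Real.pi

/-- Green's function of the discrete wave equation on `ℤ^d` (a real number,
realized as the real part of the defining integral). -/
noncomputable def greenG (d : ℕ) (x : Fin d → ℤ) (t : ℝ) : ℝ :=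
  (((2 * Real.pi : ℂ) ^ d)⁻¹ *
    ∫ ξ in torusBox d,
      Complex.exp (Complex.I * ((∑ j, (x j : ℝ) * ξ j : ℝ) : ℂ)) *
        ((Real.sin (t * discOmega d ξ) / discOmega d ξ : ℝ) : ℂ)).re

/-- the `l^p` norm on `ℤ^d` (with respect to counting measure). -/
noncomputable def lpNorm (d : ℕ) (p : ℝ≥0∞) (f : (Fin d → ℤ) → ℝ) : ℝ≥0∞ :=
  eLpNorm f p Measure.count

/-- The Cauchy–Schlömilch substitution for an even integrand. -/
theorem integral_cauchy_schlomilch {g : ℝ → ℂ} (hg : Continuous g) (hint : Integrable g)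
    (heven : ∀ y, g (-y) = g y) {a b : ℝ} (ha : 0 < a) (hb : 0 < b) :
    IntegrableOn (fun q => g (a * q - b / q)) (Set.Ioi 0) ∧
      ∫ y, g y = (2 * a : ℝ) • ∫ q in Set.Ioi (0 : ℝ), g (a * q - b / q) := by
  set f : ℝ → ℝ := fun q => a * q - b / q with hf
  have hder : ∀ q ∈ Set.Ioi (0 : ℝ), HasDerivWithinAt f (a + b / q ^ 2) (Set.Ioi 0) q := by
    intro q hq
    have hq0 : q ≠ 0 := ne_of_gt hq
    have h := ((hasDerivAt_id q).const_mul a).sub ((hasDerivAt_const q b).div (hasDerivAt_id q) hq0)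
    refine (h.congr_deriv ?_).hasDerivWithinAt
    simp only [id]; field_simp; ring
  have hinj : Set.InjOn f (Set.Ioi 0) := by
    apply StrictMonoOn.injOn
    intro p hp q hq hpq
    have hp : 0 < p := hp
    have : b / q < b / p := div_lt_div_of_pos_left hb hp hpq
    have : a * p < a * q := mul_lt_mul_of_pos_left hpq ha
    simp only [hf]; linarith
  have himg : f '' Set.Ioi 0 = Set.univ := by
    apply Set.eq_univ_of_forall
    intro y
    have hs : |y| < √(y ^ 2 + 4 * a * b) := by
      rw [← Real.sqrt_sq_eq_abs]
      exact Real.sqrt_lt_sqrt (sq_nonneg _) (by nlinarith [mul_pos ha hb])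
    have hsq : √(y ^ 2 + 4 * a * b) ^ 2 = y ^ 2 + 4 * a * b := Real.sq_sqrt (by positivity)
    set s := √(y ^ 2 + 4 * a * b)
    have hpos : 0 < y + s := by linarith [neg_abs_le y]
    refine ⟨(y + s) / (2 * a), div_pos hpos (by positivity), ?_⟩
    simp only [hf]
    field_simp
    nlinarith
  have h1 := integral_image_eq_integral_abs_deriv_smul measurableSet_Ioi hder hinj g
  have h1i := (integrableOn_image_iff_integrableOn_abs_deriv_smul measurableSet_Ioi hder hinj g).1
    (by rw [himg]; exact hint.integrableOn)
  rw [himg, setIntegral_univ] at h1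
  have habs : ∀ q : ℝ, |a + b / q ^ 2| = a + b / q ^ 2 := fun q => abs_of_pos (by positivity)
  simp only [habs] at h1 h1i
  have hmeas : AEStronglyMeasurable (fun q => g (f q)) (volume.restrict (Set.Ioi 0)) := by
    apply Measurable.aestronglyMeasurable
    exact hg.measurable.comp (by fun_prop)
  have hi : IntegrableOn (fun q => g (f q)) (Set.Ioi 0) := by
    refine (h1i.norm.const_mul a⁻¹).mono' hmeas (Filter.Eventually.of_forall fun q => ?_)
    rw [norm_smul, Real.norm_of_nonneg (by positivity), ← mul_assoc]
    refine le_mul_of_one_le_left (norm_nonneg _) ?_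
    rw [mul_add, inv_mul_cancel₀ ha.ne']
    have : 0 ≤ a⁻¹ * (b / q ^ 2) := by positivity
    linarith
  refine ⟨hi, ?_⟩
  set h : ℝ → ℝ := fun q => b / a / q with hh
  have hder2 : ∀ q ∈ Set.Ioi (0 : ℝ), HasDerivWithinAt h (-(b / a / q ^ 2)) (Set.Ioi 0) q := by
    intro q hq
    have hq0 : q ≠ 0 := ne_of_gt hq
    have h := ((hasDerivAt_const q (b / a)).div (hasDerivAt_id q) hq0)
    refine (h.congr_deriv ?_).hasDerivWithinAt
    simp only [id]; field_simp; ring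
  have hinv : ∀ q, q ≠ 0 → h (h q) = q := by
    intro q hq; simp only [hh]; field_simp
  have hmaps : ∀ q ∈ Set.Ioi (0 : ℝ), h q ∈ Set.Ioi (0 : ℝ) := by
    intro q hq
    have hq : 0 < q := hq
    show 0 < b / a / q
    positivity
  have hinj2 : Set.InjOn h (Set.Ioi 0) := by
    intro p hp q hq hpq
    rw [← hinv p (ne_of_gt hp), hpq, hinv q (ne_of_gt hq)]
  have himg2 : h '' Set.Ioi 0 = Set.Ioi 0 := by
    apply Set.Subset.antisymm
    · rintro _ ⟨q, hq, rfl⟩; exact hmaps q hq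
    · intro q hq; exact ⟨h q, hmaps q hq, hinv q (ne_of_gt hq)⟩
  have h2 := integral_image_eq_integral_abs_deriv_smul measurableSet_Ioi hder2 hinj2
    (fun q => g (f q))
  rw [himg2] at h2
  have h3 : ∫ q in Set.Ioi (0 : ℝ), |(-(b / a / q ^ 2))| • g (f (h q)) =
      a⁻¹ • ∫ q in Set.Ioi (0 : ℝ), (b / q ^ 2) • g (f q) := by
    rw [← integral_smul]
    refine setIntegral_congr_fun measurableSet_Ioi fun q hq => ?_
    have hq : 0 < q := hq
    have e1 : f (h q) = - f q := by simp only [hf, hh]; field_simp; ring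
    have e2 : |(-(b / a / q ^ 2))| = a⁻¹ * (b / q ^ 2) := by
      rw [abs_neg, abs_of_pos (by positivity)]; field_simp
    simp only [e1, heven, e2, smul_smul]
  rw [h3] at h2
  have hi2 : IntegrableOn (fun q => (b / q ^ 2) • g (f q)) (Set.Ioi 0) := by
    refine (h1i.sub (hi.smul a)).congr (Filter.Eventually.of_forall fun q => ?_)
    simp only [Pi.sub_apply, Pi.smul_apply, add_smul, add_sub_cancel_left]
  have h4 : ∫ q in Set.Ioi (0 : ℝ), (b / q ^ 2) • g (f q) =
      a • ∫ q in Set.Ioi (0 : ℝ), g (f q) := by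
    rw [h2, smul_smul, mul_inv_cancel₀ ha.ne', one_smul]
  rw [h1]
  simp only [add_smul]
  rw [integral_add (f := fun q => a • g (f q)) (hi.smul a) hi2, h4, integral_smul, ← add_smul, two_mul]

/-- Subordination of the half-wave phase to the Schrödinger phase. -/
theorem integral_exp_subordination {z : ℂ} (hz : z.re < 0) {t w : ℝ} (ht : 0 < t) (hw : 0 < w) :
    IntegrableOn (fun r : ℝ => cexp (z * t * (w ^ 2 * r ^ 2 + 1 / (4 * r ^ 2)))) (Set.Ioi 0) ∧
      ((Real.pi / (-z)) ^ (1 / 2 : ℂ)) * (cexp (z * t * w) / w) =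
        2 * √t * ∫ r in Set.Ioi (0 : ℝ), cexp (z * t * (w ^ 2 * r ^ 2 + 1 / (4 * r ^ 2))) := by
  have hst : 0 < √t := Real.sqrt_pos.2 ht
  have hz' : 0 < (-z).re := by simpa using hz
  obtain ⟨hi, he⟩ := integral_cauchy_schlomilch (g := fun y : ℝ => cexp (-(-z) * (y : ℂ) ^ 2))
    (by fun_prop) (integrable_cexp_neg_mul_sq hz') (by intro y; simp) (a := √t * w) (b := √t / 2)
    (by positivity) (by positivity)
  have key : ∀ r ∈ Set.Ioi (0 : ℝ),
      cexp (-(-z) * ((√t * w * r - √t / 2 / r : ℝ) : ℂ) ^ 2) =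
        cexp (-(z * t * w)) * cexp (z * t * (w ^ 2 * r ^ 2 + 1 / (4 * r ^ 2))) := by
    intro r hr
    have hr0 : (r : ℂ) ≠ 0 := by exact_mod_cast ne_of_gt hr
    rw [← Complex.exp_add]
    congr 1
    have hsq : ((√t : ℝ) : ℂ) ^ 2 = t := by exact_mod_cast Real.sq_sqrt ht.le
    push_cast
    have : ((√t : ℂ) * w * r - √t / 2 / r) ^ 2 = (√t : ℂ) ^ 2 * (w * r - 1 / 2 / r) ^ 2 := by
      ring
    rw [this, hsq]
    field_simp
    ring
  have hi' := hi.congr_fun key measurableSet_Ioi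
  rw [setIntegral_congr_fun measurableSet_Ioi key, integral_const_mul,
    integral_gaussian_complex hz'] at he
  constructor
  · have := hi'.const_mul (cexp (z * t * w))
    refine this.congr (Filter.Eventually.of_forall fun r => ?_)
    simp only [← mul_assoc]
    rw [← Complex.exp_add]; simp
  · have hw0 : (w : ℂ) ≠ 0 := by exact_mod_cast hw.ne'
    rw [he, Complex.real_smul, Complex.exp_neg]
    have := Complex.exp_ne_zero (z * t * w)
    generalize ∫ r in Set.Ioi (0 : ℝ), cexp (z * t * (w ^ 2 * r ^ 2 + 1 / (4 * r ^ 2))) = J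
    push_cast
    field_simp

/-- First derivative test on a monotonicity interval of `ν + κ sin`. -/
theorem norm_integral_exp_le_of_le_abs {z : ℂ} (hzim : z.im = 1) (hzn : ‖z‖ ≤ 2) (hzre : z.re ≤ 0)
    {ν κ c l a b : ℝ} (hc : ∀ ξ : ℝ, 0 ≤ c - κ * Real.cos ξ) (hab : a ≤ b)
    (ha : -(Real.pi / 2) ≤ a) (hb : b ≤ Real.pi / 2) (hl : 0 < l)
    (hlow : ∀ ξ ∈ Set.Icc a b, l ≤ |ν + κ * Real.sin ξ|) :
    ‖∫ ξ in a..b, cexp (I * ν * ξ + z * (c - κ * Real.cos ξ : ℝ))‖ ≤ 6 / l := by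
  set Φ : ℝ → ℂ := fun ξ => I * ν * ξ + z * (c - κ * Real.cos ξ : ℝ) with hΦ
  set D : ℝ → ℂ := fun ξ => I * ν + z * (κ * Real.sin ξ : ℝ) with hD
  have hexp : ∀ ξ, ‖cexp (Φ ξ)‖ ≤ 1 := by
    intro ξ
    rw [Complex.norm_exp, Real.exp_le_one_iff]
    simp only [hΦ, add_re, mul_re, I_re, I_im, ofReal_re, ofReal_im, mul_im]
    nlinarith [hc ξ]
  have hDim : ∀ ξ, (D ξ).im = ν + κ * Real.sin ξ := by
    intro ξ
    simp only [hD, add_im, mul_im, I_re, I_im, ofReal_re, ofReal_im, hzim]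
    ring
  have hDlow : ∀ ξ, |ν + κ * Real.sin ξ| ≤ ‖D ξ‖ := fun ξ => by
    rw [← hDim]; exact Complex.abs_im_le_norm _
  have hne : ∀ ξ ∈ Set.Icc a b, ν + κ * Real.sin ξ ≠ 0 := fun ξ hξ h => by
    have := hlow ξ hξ
    rw [h, abs_zero] at this
    linarith
  have hDne : ∀ ξ ∈ Set.Icc a b, D ξ ≠ 0 := fun ξ hξ h => by
    have := hDim ξ
    rw [h] at this
    exact hne ξ hξ (by simpa using this.symm)
  have hΦd : ∀ ξ, HasDerivAt Φ (D ξ) ξ := by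
    intro ξ
    have h1 : HasDerivAt (fun ξ : ℝ => c - κ * Real.cos ξ) (κ * Real.sin ξ) ξ := by
      refine ((hasDerivAt_const ξ c).sub ((Real.hasDerivAt_cos ξ).const_mul κ)).congr_deriv ?_
      ring
    have h2 : HasDerivAt (fun ξ : ℝ => I * ν * (ξ : ℂ)) (I * ν) ξ := by
      simpa using (hasDerivAt_id ξ).ofReal_comp.const_mul (I * (ν : ℂ))
    exact h2.add (h1.ofReal_comp.const_mul z)
  have hDd : ∀ ξ, HasDerivAt D (z * (κ * Real.cos ξ : ℝ)) ξ := by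
    intro ξ
    exact (((Real.hasDerivAt_sin ξ).const_mul κ).ofReal_comp.const_mul z).const_add _
  have hDc : Continuous D := by fun_prop
  have hΦc : Continuous Φ := by fun_prop
  set R : ℝ → ℂ := fun ξ => cexp (Φ ξ) * (z * (κ * Real.cos ξ : ℝ)) / D ξ ^ 2 with hR
  have hRc : ContinuousOn R (Set.uIcc a b) := by
    rw [Set.uIcc_of_le hab]
    refine ContinuousOn.div (by fun_prop) (by fun_prop) fun ξ hξ => pow_ne_zero 2 (hDne ξ hξ)
  have hEi : IntervalIntegrable (fun ξ => cexp (Φ ξ)) volume a b :=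
    Continuous.intervalIntegrable (by fun_prop) _ _
  have hftc : ∫ ξ in a..b, (cexp (Φ ξ) - R ξ) = cexp (Φ b) / D b - cexp (Φ a) / D a := by
    refine intervalIntegral.integral_eq_sub_of_hasDerivAt (f := fun ξ => cexp (Φ ξ) / D ξ)
      (fun ξ hξ => ?_) (hEi.sub hRc.intervalIntegrable)
    rw [Set.uIcc_of_le hab] at hξ
    have hn := hDne ξ hξ
    refine ((hΦd ξ).cexp.div (hDd ξ) hn).congr_deriv ?_
    simp only [hR]
    field_simp
  rw [intervalIntegral.integral_sub hEi hRc.intervalIntegrable] at hftc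
  have hbd : ∀ ξ ∈ Set.Icc a b, ‖cexp (Φ ξ) / D ξ‖ ≤ 1 / l := by
    intro ξ hξ
    rw [norm_div]
    exact div_le_div₀ zero_le_one (hexp ξ) hl ((hlow ξ hξ).trans (hDlow ξ))
  set Q : ℝ → ℝ := fun ξ => κ * Real.cos ξ / (ν + κ * Real.sin ξ) ^ 2 with hQ
  have hQc : ContinuousOn Q (Set.uIcc a b) := by
    rw [Set.uIcc_of_le hab]
    refine ContinuousOn.div (by fun_prop) (by fun_prop) fun ξ hξ => pow_ne_zero 2 (hne ξ hξ)
  have hQint : ∫ ξ in a..b, Q ξ =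
      -(ν + κ * Real.sin b)⁻¹ - -(ν + κ * Real.sin a)⁻¹ := by
    refine intervalIntegral.integral_eq_sub_of_hasDerivAt
      (f := fun ξ => -(ν + κ * Real.sin ξ)⁻¹) (fun ξ hξ => ?_) hQc.intervalIntegrable
    rw [Set.uIcc_of_le hab] at hξ
    refine ((((Real.hasDerivAt_sin ξ).const_mul κ).const_add ν).inv (hne ξ hξ)).neg.congr_deriv ?_
    simp only [hQ]
    ring
  have hinv : ∀ ξ ∈ Set.Icc a b, |(ν + κ * Real.sin ξ)⁻¹| ≤ 1 / l := by
    intro ξ hξ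
    rw [abs_inv, ← one_div]
    exact one_div_le_one_div_of_le hl (hlow ξ hξ)
  have hcos : ∀ ξ ∈ Set.Icc a b, 0 ≤ Real.cos ξ := fun ξ hξ =>
    Real.cos_nonneg_of_mem_Icc ⟨ha.trans hξ.1, hξ.2.trans hb⟩
  have hQabs : ∫ ξ in a..b, |Q ξ| ≤ 2 / l := by
    have h1 : ∫ ξ in a..b, |Q ξ| = |∫ ξ in a..b, Q ξ| := by
      rcases le_total 0 κ with hκ | hκ
      · have hpos : ∀ ξ ∈ Set.uIcc a b, |Q ξ| = Q ξ := fun ξ hξ => by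
          rw [Set.uIcc_of_le hab] at hξ
          have := hcos ξ hξ
          exact abs_of_nonneg (by positivity)
        rw [intervalIntegral.integral_congr hpos, abs_of_nonneg]
        refine intervalIntegral.integral_nonneg hab fun ξ hξ => ?_
        have := hcos ξ hξ
        positivity
      · have hneg : ∀ ξ ∈ Set.Icc a b, Q ξ ≤ 0 := fun ξ hξ =>
          div_nonpos_of_nonpos_of_nonneg (mul_nonpos_of_nonpos_of_nonneg hκ (hcos ξ hξ))
            (sq_nonneg _)
        have hpos : ∀ ξ ∈ Set.uIcc a b, |Q ξ| = -Q ξ := fun ξ hξ => by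
          rw [Set.uIcc_of_le hab] at hξ
          exact abs_of_nonpos (hneg ξ hξ)
        rw [intervalIntegral.integral_congr hpos, intervalIntegral.integral_neg, abs_of_nonpos]
        have := intervalIntegral.integral_nonneg (f := fun ξ => -Q ξ) (μ := volume) hab
          fun ξ hξ => neg_nonneg.2 (hneg ξ hξ)
        rw [intervalIntegral.integral_neg] at this
        linarith
    rw [h1, hQint]
    have e1 := hinv a ⟨le_rfl, hab⟩
    have e2 := hinv b ⟨hab, le_rfl⟩
    have : (2 : ℝ) / l = 1 / l + 1 / l := by ring
    rw [this, abs_le]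
    rw [abs_le] at e1 e2
    constructor <;> linarith
  have hRn : ‖∫ ξ in a..b, R ξ‖ ≤ 4 / l := by
    have h1 : ‖∫ ξ in a..b, R ξ‖ ≤ ∫ ξ in a..b, 2 * |Q ξ| := by
      refine intervalIntegral.norm_integral_le_of_norm_le hab
        (Filter.Eventually.of_forall fun ξ hξ => ?_) ((hQc.abs.intervalIntegrable).const_mul 2)
      have hξ' : ξ ∈ Set.Icc a b := ⟨hξ.1.le, hξ.2⟩
      simp only [hR, hQ, norm_div, norm_mul, norm_pow, abs_div, abs_pow]
      rw [← mul_div_assoc]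
      refine div_le_div₀ (by positivity) ?_ (pow_pos (hl.trans_le (hlow ξ hξ')) 2)
        (pow_le_pow_left₀ (abs_nonneg _) (hDlow ξ) 2)
      rw [Complex.norm_real, Real.norm_eq_abs]
      calc ‖cexp (Φ ξ)‖ * (‖z‖ * |κ * Real.cos ξ|) ≤ 1 * (2 * |κ * Real.cos ξ|) := by
            gcongr
            exact hexp ξ
        _ = _ := one_mul _
    rw [intervalIntegral.integral_const_mul] at h1
    calc _ ≤ _ := h1
      _ ≤ 2 * (2 / l) := by gcongr
      _ = _ := by ring
  have : ∫ ξ in a..b, cexp (Φ ξ) =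
      cexp (Φ b) / D b - cexp (Φ a) / D a + ∫ ξ in a..b, R ξ := by rw [← hftc]; ring
  rw [this]
  calc _ ≤ ‖cexp (Φ b) / D b‖ + ‖cexp (Φ a) / D a‖ + ‖∫ ξ in a..b, R ξ‖ :=
        (norm_add_le _ _).trans (by gcongr; exact norm_sub_le _ _)
    _ ≤ 1 / l + 1 / l + 4 / l := by
        gcongr
        · exact hbd b ⟨hab, le_rfl⟩
        · exact hbd a ⟨le_rfl, hab⟩
    _ = 6 / l := by ring

/-- Length of a sublevel interval of `|sin - p|`. -/
theorem sq_arcsin_sub_arcsin_mul_le (p : ℝ) {δ : ℝ} (hδ : 0 < δ) :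
    (Real.arcsin (p + δ) - Real.arcsin (p - δ)) ^ 2 * |(1 - |p|)| ≤ 32 * δ ^ 2 := by
  set b := Real.arcsin (p + δ) with hb
  set a := Real.arcsin (p - δ) with ha
  have hpi := Real.pi_pos
  have hab : a ≤ b := Real.monotone_arcsin (by linarith)
  have ha1 : -(Real.pi / 2) ≤ a := Real.neg_pi_div_two_le_arcsin _
  have hb1 : b ≤ Real.pi / 2 := Real.arcsin_le_pi_div_two _
  obtain ⟨h, hh⟩ : ∃ h, h = (b - a) / 2 := ⟨_, rfl⟩
  obtain ⟨m, hm⟩ : ∃ m, m = (a + b) / 2 := ⟨_, rfl⟩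
  have hbe : b = m + h := by rw [hm, hh]; ring
  have hae : a = m - h := by rw [hm, hh]; ring
  have hh0 : 0 ≤ h := by rw [hh]; linarith
  have hh1 : h ≤ Real.pi / 2 := by rw [hh]; linarith
  have hsinh : h / 2 ≤ Real.sin h := by
    have := Real.mul_le_sin hh0 hh1
    have h2 : (1 : ℝ) / 2 ≤ 2 / Real.pi := by
      rw [div_le_div_iff₀ two_pos hpi]; linarith [Real.pi_le_four]
    nlinarith
  have hdiff : Real.sin b - Real.sin a = 2 * (Real.sin h * Real.cos m) := by
    rw [hbe, hae, Real.sin_add, Real.sin_sub]; ring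
  have hclip : ∀ x y : ℝ, x ≤ y → Real.sin (Real.arcsin y) - Real.sin (Real.arcsin x) ≤ y - x := by
    intro x y hxy
    have e : ∀ w, Real.sin (Real.arcsin w) = max (-1) (min 1 w) := by
      intro w
      rcases le_total w (-1) with h1 | h1
      · rw [Real.arcsin_of_le_neg_one h1, Real.sin_neg, Real.sin_pi_div_two]
        rw [max_eq_left]; exact (min_le_right _ _).trans h1
      · rcases le_total w 1 with h2 | h2
        · rw [Real.sin_arcsin h1 h2, min_eq_right h2, max_eq_right h1]
        · rw [Real.arcsin_of_one_le h2, Real.sin_pi_div_two, min_eq_left h2, max_eq_right]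
          norm_num
    rw [e, e]
    grind
  have hprod : Real.sin h * Real.cos m ≤ δ := by
    have := hclip (p - δ) (p + δ) (by linarith)
    rw [← ha, ← hb, hdiff] at this
    linarith
  have hsin0 : 0 ≤ Real.sin h := by linarith
  have hab2 : b - a = 2 * h := by rw [hh]; ring
  rw [hab2]
  rcases le_or_gt |(1 - |p|)| (2 * δ) with hD | hD
  · have hcosm : Real.sin h ≤ Real.cos m := by
      rw [← Real.cos_pi_div_two_sub, ← Real.cos_abs m]
      refine Real.cos_le_cos_of_nonneg_of_le_pi (abs_nonneg _) (by linarith) ?_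
      rw [abs_le]; constructor <;> linarith
    have h1 : Real.sin h ^ 2 ≤ δ := by nlinarith
    have h2 : h ^ 2 ≤ 4 * δ := by nlinarith
    calc (2 * h) ^ 2 * |(1 - |p|)| = 4 * (h ^ 2 * |(1 - |p|)|) := by ring
      _ ≤ 4 * (4 * δ * (2 * δ)) := by gcongr
      _ = _ := by ring
  · rcases le_or_gt 1 |p| with hp | hp
    · have hzero : h = 0 := by
        rw [abs_of_nonpos (by linarith)] at hD
        rcases le_total 0 p with hp0 | hp0
        · rw [abs_of_nonneg hp0] at hD hp
          rw [hh, ha, hb, Real.arcsin_of_one_le (by linarith), Real.arcsin_of_one_le (by linarith)]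
          simp
        · rw [abs_of_nonpos hp0] at hD hp
          rw [hh, ha, hb, Real.arcsin_of_le_neg_one (by linarith),
            Real.arcsin_of_le_neg_one (by linarith)]
          simp
      rw [hzero]; simp; positivity
    · rw [abs_of_pos (by linarith)] at hD ⊢
      have hp' := abs_lt.1 hp
      have hs : ∀ x : ℝ, |x - p| ≤ δ → √((1 - |p|) / 2) ≤ Real.cos (Real.arcsin x) := by
        intro x hx
        rw [Real.cos_arcsin]
        refine Real.sqrt_le_sqrt ?_
        have hx1 : |x| ≤ |p| + δ := by
          have := abs_add_le (x - p) p
          rw [sub_add_cancel] at this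
          linarith
        have : x ^ 2 ≤ ((1 + |p|) / 2) ^ 2 := by
          rw [← sq_abs x]
          exact pow_le_pow_left₀ (abs_nonneg _) (by linarith) 2
        nlinarith [abs_nonneg p]
      have hcb := hs (p + δ) (by simp [abs_of_pos hδ])
      have hca := hs (p - δ) (by simp [abs_of_pos hδ])
      rw [← hb] at hcb
      rw [← ha] at hca
      have hcm : Real.cos m * Real.cos h = (Real.cos a + Real.cos b) / 2 := by
        rw [hae, hbe, Real.cos_add, Real.cos_sub]; ring
      have hcm0 : 0 ≤ Real.cos m := Real.cos_nonneg_of_mem_Icc ⟨by linarith, by linarith⟩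
      have hcm1 : √((1 - |p|) / 2) ≤ Real.cos m := by
        have := Real.cos_le_one h
        nlinarith
      have hsq : √((1 - |p|) / 2) ^ 2 = (1 - |p|) / 2 := Real.sq_sqrt (by linarith)
      have h3 : h / 2 * √((1 - |p|) / 2) ≤ δ := by
        refine le_trans ?_ hprod
        gcongr
      have h4 : (h / 2 * √((1 - |p|) / 2)) ^ 2 ≤ δ ^ 2 :=
        pow_le_pow_left₀ (by positivity) h3 2
      rw [mul_pow, hsq] at h4
      nlinarith

/-- Oscillatory integral over a half period, with the Airy-type weight. -/
theorem norm_integral_half_period_pow_le {z : ℂ} (hzim : z.im = 1) (hzn : ‖z‖ ≤ 2)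
    (hzre : z.re ≤ 0) {ν κ c : ℝ} (hc : ∀ ξ : ℝ, 0 ≤ c - κ * Real.cos ξ) (hκ : κ ≠ 0) :
    ‖∫ ξ in -(Real.pi / 2)..Real.pi / 2, cexp (I * ν * ξ + z * (c - κ * Real.cos ξ : ℝ))‖ ^ 4 *
      (|κ| * |(|κ| - |ν|)|) ≤ 18 ^ 4 := by
  set J := ∫ ξ in -(Real.pi / 2)..Real.pi / 2, cexp (I * ν * ξ + z * (c - κ * Real.cos ξ : ℝ))
  have hκ0 : 0 < |κ| := abs_pos.2 hκ
  have hpi := Real.pi_pos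
  set p : ℝ := -ν / κ with hp
  have hpabs : |p| = |ν| / |κ| := by rw [hp, abs_div, abs_neg]
  have hD : |κ| * |(|κ| - |ν|)| = |κ| ^ 2 * |(1 - |p|)| := by
    have : |κ| - |ν| = |κ| * (1 - |p|) := by rw [hpabs]; field_simp
    rw [this, abs_mul, abs_abs]; ring
  rw [hD]
  rcases (abs_nonneg (1 - |p|)).eq_or_lt with h0 | h0
  · rw [← h0]; norm_num
  set e := √(√|(1 - |p|)|) with he
  have he4 : e ^ 4 = |(1 - |p|)| := by
    have : e ^ 4 = (e ^ 2) ^ 2 := by ring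
    rw [this, he, Real.sq_sqrt (by positivity), Real.sq_sqrt (by positivity)]
  have he0 : 0 < e := by positivity
  set f := √|κ| with hf
  have hf2 : f ^ 2 = |κ| := Real.sq_sqrt hκ0.le
  have hf0 : 0 < f := by positivity
  set δ := e / f with hδ
  have hδ0 : 0 < δ := by positivity
  set b := Real.arcsin (p + δ) with hb
  set a := Real.arcsin (p - δ) with ha
  have hab : a ≤ b := Real.monotone_arcsin (by linarith)
  have ha1 : -(Real.pi / 2) ≤ a := Real.neg_pi_div_two_le_arcsin _
  have hb1 : b ≤ Real.pi / 2 := Real.arcsin_le_pi_div_two _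
  have hlen := sq_arcsin_sub_arcsin_mul_le p hδ0
  rw [← ha, ← hb, ← he4, hδ] at hlen
  have hlen' : (b - a) * (e * f) ≤ 6 := by
    have h1 : ((b - a) * (e * f)) ^ 2 ≤ 32 := by
      have h2 : (b - a) ^ 2 * e ^ 4 * (f ^ 2 / e ^ 2) ≤ 32 * (e / f) ^ 2 * (f ^ 2 / e ^ 2) := by
        gcongr
      calc _ = (b - a) ^ 2 * e ^ 4 * (f ^ 2 / e ^ 2) := by field_simp
        _ ≤ _ := h2
        _ = 32 := by field_simp
    nlinarith [mul_nonneg (sub_nonneg.2 hab) (mul_pos he0 hf0).le]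
  have hl0 : 0 < e * f := mul_pos he0 hf0
  have hlow : ∀ ξ, δ ≤ |Real.sin ξ - p| → e * f ≤ |ν + κ * Real.sin ξ| := by
    intro ξ hξ
    have : ν + κ * Real.sin ξ = κ * (Real.sin ξ - p) := by rw [hp]; field_simp; ring
    rw [this, abs_mul, ← hf2]
    calc e * f = f ^ 2 * δ := by rw [hδ]; field_simp
      _ ≤ _ := by gcongr
  have hint : ∀ x y : ℝ, IntervalIntegrable
      (fun ξ : ℝ => cexp (I * ν * ξ + z * (c - κ * Real.cos ξ : ℝ))) volume x y :=
    fun x y => Continuous.intervalIntegrable (by fun_prop) _ _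
  have hsplit : J = (∫ ξ in -(Real.pi / 2)..a, cexp (I * ν * ξ + z * (c - κ * Real.cos ξ : ℝ))) +
      (∫ ξ in a..b, cexp (I * ν * ξ + z * (c - κ * Real.cos ξ : ℝ))) +
      ∫ ξ in b..Real.pi / 2, cexp (I * ν * ξ + z * (c - κ * Real.cos ξ : ℝ)) := by
    rw [intervalIntegral.integral_add_adjacent_intervals (hint _ _) (hint _ _),
      intervalIntegral.integral_add_adjacent_intervals (hint _ _) (hint _ _)]
  have hmid : ‖∫ ξ in a..b, cexp (I * ν * ξ + z * (c - κ * Real.cos ξ : ℝ))‖ ≤ b - a := by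
    have := intervalIntegral.norm_integral_le_of_norm_le_const (a := a) (b := b) (C := 1)
      (f := fun ξ : ℝ => cexp (I * ν * ξ + z * (c - κ * Real.cos ξ : ℝ))) (fun ξ _ => by
        rw [Complex.norm_exp, Real.exp_le_one_iff]
        simp only [add_re, mul_re, I_re, I_im, ofReal_re, ofReal_im, mul_im]
        nlinarith [hc ξ])
    rwa [one_mul, abs_of_nonneg (by linarith)] at this
  have hleft : ‖∫ ξ in -(Real.pi / 2)..a, cexp (I * ν * ξ + z * (c - κ * Real.cos ξ : ℝ))‖ ≤
      6 / (e * f) := by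
    rcases ha1.eq_or_lt with h | h
    · rw [← h]; simp; positivity
    refine norm_integral_exp_le_of_le_abs hzim hzn hzre hc ha1 le_rfl (hab.trans hb1) hl0
      fun ξ hξ => hlow ξ ?_
    have h1 : -1 < p - δ := by
      by_contra! hcon
      exact h.ne' (Real.arcsin_of_le_neg_one hcon)
    have h2 : Real.sin ξ ≤ p - δ := by
      rcases le_total (p - δ) 1 with h3 | h3
      · rw [← Real.sin_arcsin h1.le h3]
        exact Real.monotoneOn_sin ⟨hξ.1, hξ.2.trans (hab.trans hb1)⟩ ⟨ha1, hab.trans hb1⟩ hξ.2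
      · exact (Real.sin_le_one ξ).trans h3
    rw [abs_sub_comm]
    exact le_trans (by linarith) (le_abs_self _)
  have hright : ‖∫ ξ in b..Real.pi / 2, cexp (I * ν * ξ + z * (c - κ * Real.cos ξ : ℝ))‖ ≤
      6 / (e * f) := by
    rcases hb1.eq_or_lt with h | h
    · rw [h]; simp; positivity
    refine norm_integral_exp_le_of_le_abs hzim hzn hzre hc hb1 (ha1.trans hab) le_rfl hl0
      fun ξ hξ => hlow ξ ?_
    have h1 : p + δ < 1 := by
      by_contra! hcon
      exact h.ne (Real.arcsin_of_one_le hcon)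
    have h2 : p + δ ≤ Real.sin ξ := by
      rcases le_total (-1) (p + δ) with h3 | h3
      · rw [← Real.sin_arcsin h3 h1.le]
        exact Real.monotoneOn_sin ⟨ha1.trans hab, hb1⟩ ⟨(ha1.trans hab).trans hξ.1, hξ.2⟩ hξ.1
      · exact h3.trans (Real.neg_one_le_sin ξ)
    exact le_trans (by linarith) (le_abs_self _)
  have hJ : ‖J‖ * (e * f) ≤ 18 := by
    have h1 : ‖J‖ ≤ 6 / (e * f) + (b - a) + 6 / (e * f) := by
      rw [hsplit]
      exact (norm_add_le _ _).trans (add_le_add ((norm_add_le _ _).trans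
        (add_le_add hleft hmid)) hright)
    calc ‖J‖ * (e * f) ≤ (6 / (e * f) + (b - a) + 6 / (e * f)) * (e * f) := by gcongr
      _ = 12 + (b - a) * (e * f) := by field_simp; ring
      _ ≤ 18 := by linarith
  calc ‖J‖ ^ 4 * (|κ| ^ 2 * |(1 - |p|)|) = (‖J‖ * (e * f)) ^ 4 := by
        rw [← he4, ← hf2]; ring
    _ ≤ 18 ^ 4 := pow_le_pow_left₀ (by positivity) hJ 4

/-- The one-dimensional discrete Schrödinger kernel at complex time `ζ`, up to normalization. -/
noncomputable def schrodKernel (n : ℤ) (ζ : ℂ) : ℂ :=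
  ∫ ξ in Set.Icc (-Real.pi) Real.pi, cexp (I * (n * ξ) + ζ * (2 - 2 * Real.cos ξ : ℝ))

theorem schrodKernel_pow_le {z : ℂ} (hzim : z.im = 1) (hzn : ‖z‖ ≤ 2) (hzre : z.re ≤ 0)
    (n : ℤ) {s : ℝ} (hs : 0 < s) :
    ‖schrodKernel n (z * s)‖ ^ 4 * (s * |s - |(n : ℝ)| / 2|) ≤ 18 ^ 4 * 16 := by
  have hpi := Real.pi_pos
  set f : ℝ → ℂ := fun ξ => cexp (I * (n * ξ) + (z * s) * (2 - 2 * Real.cos ξ : ℝ)) with hf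
  have hfc : Continuous f := by fun_prop
  have hper : Function.Periodic f (2 * Real.pi) := by
    intro ξ
    simp only [hf, Real.cos_add_two_pi]
    have : I * (n * ((ξ + 2 * Real.pi : ℝ) : ℂ)) + (z * s) * (2 - 2 * Real.cos ξ : ℝ) =
        I * (n * ξ) + (z * s) * (2 - 2 * Real.cos ξ : ℝ) + n * (2 * Real.pi * I) := by
      push_cast; ring
    rw [this, Complex.exp_add, Complex.exp_int_mul_two_pi_mul_I, mul_one]
  have h1 : schrodKernel n (z * s) = ∫ ξ in -(Real.pi / 2)..(-(Real.pi / 2) + 2 * Real.pi), f ξ := by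
    rw [schrodKernel, integral_Icc_eq_integral_Ioc, ← intervalIntegral.integral_of_le (by linarith)]
    have := hper.intervalIntegral_add_eq (-Real.pi) (-(Real.pi / 2))
    rw [← this]
    congr 1; ring
  have h2 : ∫ ξ in -(Real.pi / 2)..(-(Real.pi / 2) + 2 * Real.pi), f ξ =
      (∫ ξ in -(Real.pi / 2)..Real.pi / 2, f ξ) +
        ∫ ξ in -(Real.pi / 2)..Real.pi / 2, f (ξ + Real.pi) := by
    rw [intervalIntegral.integral_comp_add_right,
      ← intervalIntegral.integral_add_adjacent_intervals (hfc.intervalIntegrable _ _)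
        (hfc.intervalIntegrable (Real.pi / 2) _)]
    congr 2 <;> ring
  have e1 : ∀ ξ, f ξ = cexp (I * (n : ℝ) * ξ + z * (2 * s - (2 * s) * Real.cos ξ : ℝ)) := by
    intro ξ; simp only [hf]; congr 1; push_cast; ring
  have e2 : ∀ ξ, f (ξ + Real.pi) = cexp (I * n * Real.pi) *
      cexp (I * (n : ℝ) * ξ + z * (2 * s - (-(2 * s)) * Real.cos ξ : ℝ)) := by
    intro ξ; rw [← Complex.exp_add]; simp only [hf, Real.cos_add_pi]; congr 1; push_cast; ring
  have b1 := norm_integral_half_period_pow_le hzim hzn hzre (ν := n) (κ := 2 * s) (c := 2 * s)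
    (fun ξ => by nlinarith [Real.cos_le_one ξ]) (by positivity)
  have b2 := norm_integral_half_period_pow_le hzim hzn hzre (ν := n) (κ := -(2 * s)) (c := 2 * s)
    (fun ξ => by nlinarith [Real.neg_one_le_cos ξ]) (by simpa using hs.ne')
  rw [h1, h2]
  simp only [e2]
  simp only [e1]
  rw [intervalIntegral.integral_const_mul]
  rw [abs_neg] at b2
  set A := ∫ ξ in -(Real.pi / 2)..Real.pi / 2,
    cexp (I * (n : ℝ) * ξ + z * (2 * s - (2 * s) * Real.cos ξ : ℝ))
  set B := ∫ ξ in -(Real.pi / 2)..Real.pi / 2,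
    cexp (I * (n : ℝ) * ξ + z * (2 * s - (-(2 * s)) * Real.cos ξ : ℝ))
  have hn : ‖cexp (I * n * Real.pi)‖ = 1 := by
    rw [Complex.norm_exp]
    simp
  have hsum : ‖A + cexp (I * n * Real.pi) * B‖ ≤ ‖A‖ + ‖B‖ := by
    refine (norm_add_le _ _).trans ?_
    rw [norm_mul, hn, one_mul]
  have hw : |2 * s| * |(|2 * s| - |(n : ℝ)|)| = 4 * (s * |s - |(n : ℝ)| / 2|) := by
    have : 2 * s - |(n : ℝ)| = 2 * (s - |(n : ℝ)| / 2) := by ring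
    rw [abs_of_pos (by positivity : 0 < 2 * s), this, abs_mul, abs_of_pos (two_pos : (0 : ℝ) < 2)]
    ring
  rw [hw] at b1 b2
  set W := s * |s - |(n : ℝ)| / 2|
  have hW : 0 ≤ W := by positivity
  have h4 : (‖A‖ + ‖B‖) ^ 4 ≤ 8 * (‖A‖ ^ 4 + ‖B‖ ^ 4) := by
    have := add_pow_le (norm_nonneg A) (norm_nonneg B) 4
    norm_num at this
    exact this
  calc _ ≤ (‖A‖ + ‖B‖) ^ 4 * W := by gcongr
    _ ≤ 8 * (‖A‖ ^ 4 + ‖B‖ ^ 4) * W := by gcongr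
    _ ≤ _ := by nlinarith

theorem norm_subordination_kernel_le {τ : ℂ} (hτ : τ.re ≤ 0) {l : ℝ} (hl : 0 ≤ l) (r : ℝ) :
    ‖cexp (τ * (l * r ^ 2 + 1 / (4 * r ^ 2) : ℝ))‖ ≤ 1 := by
  rw [Complex.norm_exp, Real.exp_le_one_iff]
  simp only [mul_re, ofReal_re, ofReal_im, mul_zero, sub_zero]
  exact mul_nonpos_of_nonpos_of_nonneg hτ (by positivity)

/-- Twice integrated by parts, the smoothly truncated nonstationary part decays quadratically. -/
theorem exists_norm_integral_nonstationary_le :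
    ∃ C : ℝ, 0 < C ∧ ∀ l ∈ Set.Icc (0 : ℝ) 16, ∀ τ : ℂ, τ ≠ 0 → τ.re ≤ 0 →
      ‖∫ r in (0 : ℝ)..1 / 4, ((1 - 256 * r ^ 4) ^ 3 : ℝ) *
        cexp (τ * (l * r ^ 2 + 1 / (4 * r ^ 2) : ℝ))‖ ≤ C / ‖τ‖ ^ 2 := by
  set D : ℝ × ℝ → ℝ := fun q => (1 - 4 * q.1 * q.2 ^ 4)⁻¹ with hD
  have hDpos : ∀ q ∈ Set.Icc (0 : ℝ) 16 ×ˢ Set.Icc (0 : ℝ) (1 / 4), 0 < 1 - 4 * q.1 * q.2 ^ 4 := by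
    rintro ⟨l, r⟩ ⟨hl, hr⟩
    simp only [Set.mem_Icc] at hl hr ⊢
    have h1 : r ^ 4 ≤ (1 / 4) ^ 4 := pow_le_pow_left₀ hr.1 hr.2 4
    have h2 : l * r ^ 4 ≤ 16 * (1 / 4) ^ 4 := by
      apply mul_le_mul hl.2 h1 (by have := hr.1; positivity) (by norm_num)
    norm_num at h2
    nlinarith
  set g : ℝ × ℝ → ℝ := fun q => -2 * q.2 ^ 3 * D q with hg
  set g1 : ℝ × ℝ → ℝ := fun q => -6 * q.2 ^ 2 * D q - 32 * q.1 * q.2 ^ 6 * D q ^ 2 with hg1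
  set g2 : ℝ × ℝ → ℝ := fun q => -12 * q.2 * D q - 288 * q.1 * q.2 ^ 5 * D q ^ 2
    - 1024 * q.1 ^ 2 * q.2 ^ 9 * D q ^ 3 with hg2
  set c : ℝ → ℝ := fun r => (1 - 256 * r ^ 4) ^ 3 with hc
  set c1 : ℝ → ℝ := fun r => -3072 * r ^ 3 * (1 - 256 * r ^ 4) ^ 2 with hc1
  set c2 : ℝ → ℝ := fun r => -9216 * r ^ 2 * (1 - 256 * r ^ 4) ^ 2
    + 6291456 * r ^ 6 * (1 - 256 * r ^ 4) with hc2
  set k1 : ℝ × ℝ → ℝ := fun q => g1 q * c q.2 + g q * c1 q.2 with hk1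
  set k2 : ℝ × ℝ → ℝ := fun q => g1 q * k1 q + g q * (g2 q * c q.2 + 2 * g1 q * c1 q.2
    + g q * c2 q.2) with hk2
  have hDc : ContinuousOn D (Set.Icc (0 : ℝ) 16 ×ˢ Set.Icc (0 : ℝ) (1 / 4)) :=
    ContinuousOn.inv₀ (by fun_prop) fun q hq => (hDpos q hq).ne'
  have hk2c : ContinuousOn k2 (Set.Icc (0 : ℝ) 16 ×ˢ Set.Icc (0 : ℝ) (1 / 4)) := by fun_prop
  have hk1c : ContinuousOn k1 (Set.Icc (0 : ℝ) 16 ×ˢ Set.Icc (0 : ℝ) (1 / 4)) := by fun_prop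
  have hgc : ContinuousOn g (Set.Icc (0 : ℝ) 16 ×ˢ Set.Icc (0 : ℝ) (1 / 4)) := by fun_prop
  obtain ⟨C, hC⟩ := (isCompact_Icc.prod isCompact_Icc).exists_bound_of_continuousOn hk2c
  refine ⟨max C 1, by positivity, fun l hl τ hτ0 hτ => ?_⟩
  have hpair : ContinuousOn (fun r : ℝ => (l, r)) (Set.Icc 0 (1 / 4)) := by fun_prop
  have hmap : Set.MapsTo (fun r : ℝ => (l, r)) (Set.Icc 0 (1 / 4))
      (Set.Icc (0 : ℝ) 16 ×ˢ Set.Icc (0 : ℝ) (1 / 4)) := fun r hr => ⟨hl, hr⟩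
  have hk2r := hk2c.comp hpair hmap
  have hk1r := hk1c.comp hpair hmap
  have hgr := hgc.comp hpair hmap
  set K : ℝ → ℂ := fun r => cexp (τ * (l * r ^ 2 + 1 / (4 * r ^ 2) : ℝ)) with hK
  have hK1 : ∀ r, ‖K r‖ ≤ 1 := norm_subordination_kernel_le hτ hl.1
  have hKm : Measurable K := by fun_prop
  have hKi : IntervalIntegrable K volume 0 (1 / 4) :=
    (intervalIntegrable_const (c := (1 : ℝ))).mono_fun' hKm.aestronglyMeasurable
      (Filter.Eventually.of_forall hK1)
  set E : ℝ → ℂ := fun r => (g (l, r) * c r : ℝ) / τ - (g (l, r) * k1 (l, r) : ℝ) / τ ^ 2 with hE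
  have hEc : ContinuousOn E (Set.Icc 0 (1 / 4)) := by
    have h1 : ContinuousOn (fun r => (g (l, r) * c r : ℝ)) (Set.Icc 0 (1 / 4)) :=
      hgr.mul (by fun_prop)
    have h2 : ContinuousOn (fun r => (g (l, r) * k1 (l, r) : ℝ)) (Set.Icc 0 (1 / 4)) :=
      hgr.mul hk1r
    exact ((Complex.continuous_ofReal.comp_continuousOn h1).div_const _).sub
      ((Complex.continuous_ofReal.comp_continuousOn h2).div_const _)
  have hE0 : E 0 = 0 := by simp [hE, hg]
  have hE1 : E (1 / 4) = 0 := by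
    have h1 : c (1 / 4) = 0 := by norm_num [hc]
    have h2 : c1 (1 / 4) = 0 := by norm_num [hc1]
    simp only [hE, hk1, h1, h2]; simp
  have hder : ∀ r ∈ Set.Ioc (0 : ℝ) (1 / 4), HasDerivAt (fun r => E r * K r)
      ((c r : ℂ) * K r - (k2 (l, r) : ℂ) / τ ^ 2 * K r) r := by
    intro r hr
    have hr0 : r ≠ 0 := hr.1.ne'
    have hd := (hDpos (l, r) (hmap ⟨hr.1.le, hr.2⟩)).ne'
    simp only at hd
    have dD : HasDerivAt (fun r => D (l, r)) (16 * l * r ^ 3 * D (l, r) ^ 2) r := by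
      have := (((hasDerivAt_pow 4 r).const_mul (4 * l)).const_sub 1).inv hd
      refine this.congr_deriv ?_
      simp only [hD]; field_simp; norm_num; ring
    have dg : HasDerivAt (fun r => g (l, r)) (g1 (l, r)) r := by
      refine (((hasDerivAt_pow 3 r).const_mul (-2)).mul dD).congr_deriv ?_
      simp only [hg1]; norm_num; ring
    have dg1 : HasDerivAt (fun r => g1 (l, r)) (g2 (l, r)) r := by
      refine ((((hasDerivAt_pow 2 r).const_mul (-6)).mul dD).sub
        (((hasDerivAt_pow 6 r).const_mul (32 * l)).mul (dD.pow 2))).congr_deriv ?_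
      simp only [hg2]; norm_num; ring
    have db : HasDerivAt (fun r : ℝ => 1 - 256 * r ^ 4) (-(256 * (4 * r ^ 3))) r := by
      refine (((hasDerivAt_pow 4 r).const_mul 256).const_sub 1).congr_deriv ?_
      norm_num
    have dc : HasDerivAt c (c1 r) r := by
      refine (db.pow 3).congr_deriv ?_
      simp only [hc1]; norm_num; ring
    have dc1 : HasDerivAt c1 (c2 r) r := by
      refine (((hasDerivAt_pow 3 r).const_mul (-3072)).mul (db.pow 2)).congr_deriv ?_
      simp only [hc2]; norm_num; ring
    have dk1 : HasDerivAt (fun r => k1 (l, r)) (g2 (l, r) * c r + 2 * g1 (l, r) * c1 r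
        + g (l, r) * c2 r) r := by
      refine ((dg1.mul dc).add (dg.mul dc1)).congr_deriv ?_
      ring
    have dgc : HasDerivAt (fun r => g (l, r) * c r) (k1 (l, r)) r := dg.mul dc
    have dgk : HasDerivAt (fun r => g (l, r) * k1 (l, r)) (k2 (l, r)) r := dg.mul dk1
    have dψ : HasDerivAt (fun r : ℝ => l * r ^ 2 + 1 / (4 * r ^ 2)) (2 * l * r - 1 / (2 * r ^ 3)) r := by
      have := ((hasDerivAt_pow 2 r).const_mul l).add
        ((hasDerivAt_const r (1 : ℝ)).div ((hasDerivAt_pow 2 r).const_mul 4) (by positivity))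
      refine this.congr_deriv ?_
      norm_num; field_simp; ring
    have hgψ : (g (l, r) : ℂ) * (2 * l * r - 1 / (2 * r ^ 3) : ℝ) = 1 := by
      have : g (l, r) * (2 * l * r - 1 / (2 * r ^ 3)) = 1 := by
        have hd' : (1 - 4 * l * r ^ 4) * D (l, r) = 1 := mul_inv_cancel₀ hd
        simp only [hg]
        generalize D (l, r) = y at hd'
        field_simp
        linear_combination hd'
      exact_mod_cast this
    have dE := (dgc.ofReal_comp.div_const τ).sub (dgk.ofReal_comp.div_const (τ ^ 2))
    have dK := (dψ.ofReal_comp.const_mul τ).cexp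
    refine (dE.mul dK).congr_deriv ?_
    simp only [Pi.sub_apply]
    show ((k1 (l, r) : ℂ) / τ - (k2 (l, r) : ℂ) / τ ^ 2) * K r +
      ((g (l, r) * c r : ℝ) / τ - (g (l, r) * k1 (l, r) : ℝ) / τ ^ 2) *
        (K r * (τ * (2 * l * r - 1 / (2 * r ^ 3) : ℝ))) = _
    generalize K r = Kr
    generalize k1 (l, r) = x1 at *
    generalize k2 (l, r) = x2 at *
    generalize g (l, r) = x3 at *
    generalize c r = x4 at *
    generalize (2 * l * r - 1 / (2 * r ^ 3)) = x5 at *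
    push_cast
    field_simp
    linear_combination (Kr * x4 * τ ^ 2 - Kr * x1 * τ) * hgψ
  have hEKc : ContinuousOn (fun r => E r * K r) (Set.Icc 0 (1 / 4)) := by
    intro r hr
    rcases hr.1.eq_or_lt with h | h
    · subst h
      have ht : Filter.Tendsto E (nhdsWithin 0 (Set.Icc 0 (1 / 4))) (nhds 0) := by
        have := hEc 0 hr
        rwa [ContinuousWithinAt, hE0] at this
      rw [ContinuousWithinAt, hE0, zero_mul]
      refine squeeze_zero_norm (fun r => ?_) (by simpa using ht.norm)
      rw [norm_mul]
      exact mul_le_of_le_one_right (norm_nonneg _) (hK1 r)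
    · exact (hder r ⟨h, hr.2⟩).continuousAt.continuousWithinAt
  have huIcc : Set.uIcc (0 : ℝ) (1 / 4) = Set.Icc 0 (1 / 4) := Set.uIcc_of_le (by norm_num)
  have hi1 : IntervalIntegrable (fun r => (c r : ℂ) * K r) volume 0 (1 / 4) :=
    hKi.continuousOn_mul (by fun_prop)
  have hi2 : IntervalIntegrable (fun r => (k2 (l, r) : ℂ) / τ ^ 2 * K r) volume 0 (1 / 4) := by
    refine hKi.continuousOn_mul ?_
    rw [huIcc]
    exact (Complex.continuous_ofReal.comp_continuousOn hk2r).div_const _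
  have hftc := intervalIntegral.integral_eq_sub_of_hasDerivAt_of_le (by norm_num) hEKc
    (fun r hr => hder r ⟨hr.1, hr.2.le⟩) (hi1.sub hi2)
  rw [intervalIntegral.integral_sub hi1 hi2, hE0, hE1, zero_mul, zero_mul, sub_zero,
    sub_eq_zero] at hftc
  show ‖∫ r in (0 : ℝ)..1 / 4, (c r : ℂ) * K r‖ ≤ _
  rw [hftc]
  have hb : ‖∫ r in (0 : ℝ)..1 / 4, (k2 (l, r) : ℂ) / τ ^ 2 * K r‖ ≤
      (max C 1 / ‖τ‖ ^ 2) * |1 / 4 - 0| := by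
    refine intervalIntegral.norm_integral_le_of_norm_le_const fun r hr => ?_
    rw [Set.uIoc_of_le (by norm_num)] at hr
    rw [norm_mul, norm_div, norm_pow, Complex.norm_real]
    refine (mul_le_of_le_one_right (by positivity) (hK1 r)).trans ?_
    gcongr
    exact (hC (l, r) ⟨hl, hr.1.le, hr.2⟩).trans (le_max_left _ _)
  refine hb.trans (mul_le_of_le_one_right (by positivity) (by norm_num))

theorem torusBox_eq_Icc (d : ℕ) : torusBox d = Set.Icc (fun _ => -Real.pi) (fun _ => Real.pi) :=
  Set.pi_univ_Icc _ _

theorem measurableSet_torusBox (d : ℕ) : MeasurableSet (torusBox d) := by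
  rw [torusBox_eq_Icc]; exact measurableSet_Icc

theorem volume_torusBox_lt_top (d : ℕ) : volume (torusBox d) < ∞ := by
  rw [torusBox_eq_Icc]; exact isCompact_Icc.measure_lt_top

theorem continuous_discOmega (d : ℕ) : Continuous (discOmega d) := by
  unfold discOmega; fun_prop

theorem discOmega_nonneg (d : ℕ) (ξ : Fin d → ℝ) : 0 ≤ discOmega d ξ := Real.sqrt_nonneg _

theorem discOmega_sq (d : ℕ) (ξ : Fin d → ℝ) :
    discOmega d ξ ^ 2 = ∑ j, (2 - 2 * Real.cos (ξ j)) :=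
  Real.sq_sqrt (Finset.sum_nonneg fun j _ => by linarith [Real.cos_le_one (ξ j)])

theorem discOmega_four_sq_le (ξ : Fin 4 → ℝ) : discOmega 4 ξ ^ 2 ≤ 16 := by
  rw [discOmega_sq]
  calc ∑ j, (2 - 2 * Real.cos (ξ j)) ≤ ∑ _j : Fin 4, (4 : ℝ) :=
        Finset.sum_le_sum fun j _ => by linarith [Real.neg_one_le_cos (ξ j)]
    _ = 16 := by norm_num

theorem prod_sqrt_abs_le_discOmega_sq {ξ : Fin 4 → ℝ} (hξ : ξ ∈ torusBox 4) :
    16 / Real.pi ^ 2 * ∏ j, √|ξ j| ≤ discOmega 4 ξ ^ 2 := by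
  have hpi := Real.pi_pos
  have h1 : ∀ j, 4 / Real.pi ^ 2 * √|ξ j| ^ 4 ≤ 2 - 2 * Real.cos (ξ j) := by
    intro j
    have h2 : √|ξ j| ^ 4 = ξ j ^ 2 := by
      rw [show 4 = 2 * 2 by norm_num, pow_mul, Real.sq_sqrt (abs_nonneg _), sq_abs]
    have h3 := Real.cos_le_one_sub_mul_cos_sq (abs_le.2 (hξ j (Set.mem_univ j)))
    rw [h2]
    linarith [show 4 / Real.pi ^ 2 * ξ j ^ 2 = 2 * (2 / Real.pi ^ 2 * ξ j ^ 2) by ring]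
  rw [discOmega_sq]
  calc 16 / Real.pi ^ 2 * ∏ j, √|ξ j| ≤ ∑ j, 4 / Real.pi ^ 2 * √|ξ j| ^ 4 := by
        rw [← Finset.mul_sum, show 16 / Real.pi ^ 2 = 4 / Real.pi ^ 2 * 4 by ring, mul_assoc]
        refine mul_le_mul_of_nonneg_left ?_ (by positivity)
        simp only [Fin.prod_univ_four, Fin.sum_univ_four]
        nlinarith [sq_nonneg (√|ξ 0| ^ 2 - √|ξ 1| ^ 2), sq_nonneg (√|ξ 2| ^ 2 - √|ξ 3| ^ 2),
          sq_nonneg (√|ξ 0| * √|ξ 1| - √|ξ 2| * √|ξ 3|)]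
    _ ≤ _ := Finset.sum_le_sum fun j _ => h1 j

theorem ae_forall_ne_zero : ∀ᵐ ξ : Fin 4 → ℝ, ∀ j, ξ j ≠ 0 := by
  rw [ae_all_iff]
  intro j
  rw [ae_iff]
  rw [volume_pi]
  simpa using Measure.pi_hyperplane (fun _ : Fin 4 => (volume : Measure ℝ)) j 0

theorem discOmega_pos {ξ : Fin 4 → ℝ} (hξ : ξ ∈ torusBox 4) (h : ∀ j, ξ j ≠ 0) :
    0 < discOmega 4 ξ := by
  refine (sq_pos_iff.1 (lt_of_lt_of_le ?_ (prod_sqrt_abs_le_discOmega_sq hξ))).lt_of_le'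
    (discOmega_nonneg _ _)
  have := Real.pi_pos
  have : 0 < ∏ j, √|ξ j| := Finset.prod_pos fun j _ => Real.sqrt_pos.2 (abs_pos.2 (h j))
  positivity

theorem ae_discOmega_pos : ∀ᵐ ξ ∂(volume.restrict (torusBox 4)), 0 < discOmega 4 ξ := by
  filter_upwards [ae_restrict_mem (measurableSet_torusBox 4), ae_restrict_of_ae ae_forall_ne_zero]
    with ξ h1 h2 using discOmega_pos h1 h2

theorem volume_restrict_torusBox (d : ℕ) : (volume : Measure (Fin d → ℝ)).restrict (torusBox d) =
    Measure.pi fun _ => volume.restrict (Set.Icc (-Real.pi) Real.pi) := by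
  rw [torusBox, volume_pi, Measure.restrict_pi_pi]

theorem integrableOn_inv_discOmega_sq :
    IntegrableOn (fun ξ => (discOmega 4 ξ ^ 2)⁻¹) (torusBox 4) := by
  have hpi := Real.pi_pos
  have h1 : IntegrableOn (fun x : ℝ => (√|x|)⁻¹) (Set.Icc (-Real.pi) Real.pi) := by
    have h2 : IntervalIntegrable (fun x : ℝ => (√|x|)⁻¹) volume 0 Real.pi := by
      refine (intervalIntegral.intervalIntegrable_rpow' (r := -(1 / 2)) (by norm_num)).congr ?_
      intro x hx
      rw [Set.uIoc_of_le hpi.le] at hx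
      simp only
      rw [abs_of_pos hx.1, Real.sqrt_eq_rpow, Real.rpow_neg hx.1.le]
    have h3 : IntervalIntegrable (fun x : ℝ => (√|x|)⁻¹) volume (-Real.pi) 0 := by
      rw [IntervalIntegrable.iff_comp_neg]; simpa using h2.symm
    rw [integrableOn_Icc_iff_integrableOn_Ioc, ← intervalIntegrable_iff_integrableOn_Ioc_of_le
      (by linarith)]
    exact h3.trans h2
  have h4 : Integrable (fun ξ : Fin 4 → ℝ => ∏ j, (√|ξ j|)⁻¹) (volume.restrict (torusBox 4)) := by
    rw [volume_restrict_torusBox]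
    exact Integrable.fintype_prod (f := fun _ x => (√|x|)⁻¹) fun _ => h1
  refine (h4.const_mul (Real.pi ^ 2 / 16)).mono' ?_ ?_
  · have := (continuous_discOmega 4).measurable
    exact (by fun_prop : Measurable fun ξ => (discOmega 4 ξ ^ 2)⁻¹).aestronglyMeasurable
  · filter_upwards [ae_restrict_mem (measurableSet_torusBox 4),
      ae_restrict_of_ae ae_forall_ne_zero] with ξ h5 h6
    have h7 : 0 < ∏ j, √|ξ j| := Finset.prod_pos fun j _ => Real.sqrt_pos.2 (abs_pos.2 (h6 j))
    rw [Real.norm_of_nonneg (by positivity), Finset.prod_inv_distrib]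
    refine (inv_anti₀ (by positivity) (prod_sqrt_abs_le_discOmega_sq h5)).trans_eq ?_
    rw [mul_inv, inv_div]

theorem integrableOn_inv_discOmega : IntegrableOn (fun ξ => (discOmega 4 ξ)⁻¹) (torusBox 4) := by
  have h1 : IntegrableOn (fun _ : Fin 4 → ℝ => (1 : ℝ)) (torusBox 4) :=
    integrableOn_const (volume_torusBox_lt_top 4).ne
  refine (h1.add integrableOn_inv_discOmega_sq).mono' ?_ (Filter.Eventually.of_forall fun ξ => ?_)
  · have := (continuous_discOmega 4).measurable
    exact (by fun_prop : Measurable fun ξ => (discOmega 4 ξ)⁻¹).aestronglyMeasurable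
  · have := discOmega_nonneg 4 ξ
    rw [Real.norm_of_nonneg (by positivity)]
    simp only [Pi.add_apply, ← inv_pow]
    nlinarith [sq_nonneg ((discOmega 4 ξ)⁻¹ - 1), sq_nonneg ((discOmega 4 ξ)⁻¹)]

theorem setIntegral_torusBox_eq_prod_schrodKernel {d : ℕ} (x : Fin d → ℤ) (ζ : ℂ) :
    ∫ ξ in torusBox d, cexp (I * ((∑ j, (x j : ℝ) * ξ j : ℝ) : ℂ)) *
      cexp (ζ * (discOmega d ξ ^ 2 : ℝ)) = ∏ j, schrodKernel (x j) ζ := by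
  simp only [schrodKernel]
  rw [volume_restrict_torusBox, ← integral_fintype_prod_eq_prod]
  refine integral_congr_ae (Filter.Eventually.of_forall fun ξ => ?_)
  simp only
  rw [discOmega_sq, ← Complex.exp_add, ← Complex.exp_sum, Finset.sum_add_distrib]
  push_cast
  rw [Finset.mul_sum, Finset.mul_sum]

theorem norm_schrodKernel_le (n : ℤ) {ζ : ℂ} (hζ : ζ.re ≤ 0) :
    ‖schrodKernel n ζ‖ ≤ 2 * Real.pi := by
  have hpi := Real.pi_pos
  have := norm_setIntegral_le_of_norm_le_const (μ := volume) (s := Set.Icc (-Real.pi) Real.pi)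
    (f := fun ξ : ℝ => cexp (I * (n * ξ) + ζ * (2 - 2 * Real.cos ξ : ℝ))) (C := 1)
    (by simp) (fun ξ _ => by
      rw [Complex.norm_exp, Real.exp_le_one_iff]
      have := Real.cos_le_one ξ
      have : ζ.re * (2 - 2 * Real.cos ξ) ≤ 0 := mul_nonpos_of_nonpos_of_nonneg hζ (by linarith)
      simpa [-Complex.ofReal_sub, -Complex.ofReal_mul, -Complex.ofReal_cos] using this)
  rw [schrodKernel]
  refine this.trans_eq ?_
  rw [one_mul, Real.volume_real_Icc_of_le (by linarith)]
  ring

theorem schrodKernel_pow_mul_rpow_le {z : ℂ} (hzim : z.im = 1) (hzn : ‖z‖ ≤ 2) (hzre : z.re ≤ 0)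
    (n : ℤ) {s β : ℝ} (hs : 0 < s) (hβ0 : 0 ≤ β) (hβ1 : β ≤ 1) :
    ‖schrodKernel n (z * s)‖ ^ 4 * (s * |s - |(n : ℝ)| / 2|) ^ β ≤ 18 ^ 4 * 16 := by
  set J := ‖schrodKernel n (z * s)‖ with hJ
  have h1 := schrodKernel_pow_le hzim hzn hzre n hs
  rw [← hJ] at h1
  set X := s * |s - |(n : ℝ)| / 2| with hX
  have hX0 : 0 ≤ X := by positivity
  have hJ0 : 0 ≤ J := norm_nonneg _
  have h2 : J ≤ 2 * Real.pi := norm_schrodKernel_le n (by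
    simpa using mul_nonpos_of_nonpos_of_nonneg hzre hs.le)
  have h3 : J ^ 4 ≤ 18 ^ 4 * 16 := by
    calc J ^ 4 ≤ 18 ^ 4 := pow_le_pow_left₀ hJ0 (by linarith [Real.pi_le_four]) 4
      _ ≤ _ := by norm_num
  calc J ^ 4 * X ^ β = (J ^ 4) ^ (1 - β) * (J ^ 4 * X) ^ β := by
        rcases hJ0.eq_or_lt with h | h
        · rw [← h]
          rcases hβ0.eq_or_lt with h' | h'
          · subst h'; simp
          · simp [Real.zero_rpow h'.ne']
        · rw [Real.mul_rpow (by positivity) hX0, ← mul_assoc, ← Real.rpow_add (by positivity)]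
          simp
    _ ≤ (18 ^ 4 * 16) ^ (1 - β) * (18 ^ 4 * 16) ^ β := by
        gcongr
    _ = 18 ^ 4 * 16 := by
        rw [← Real.rpow_add (by norm_num)]; simp

theorem prod_schrodKernel_le {z : ℂ} (hzim : z.im = 1) (hzn : ‖z‖ ≤ 2) (hzre : z.re ≤ 0)
    (x : Fin 4 → ℤ) {t r β : ℝ} (ht : 0 < t) (hr : 0 < r) (hβ0 : 0 ≤ β) (hβ1 : β ≤ 1)
    (hne : ∀ j, r ≠ √(|(x j : ℝ)| / 2 / t)) :
    ‖∏ j, schrodKernel (x j) (z * (t * r ^ 2 : ℝ))‖ ≤ 18 ^ 4 * 4 * t ^ (-(2 * β)) *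
      ∑ j, r ^ (-(3 * β)) * |r - √(|(x j : ℝ)| / 2 / t)| ^ (-β) := by
  have h1 : ∀ j, ‖schrodKernel (x j) (z * (t * r ^ 2 : ℝ))‖ ^ 4 ≤ 18 ^ 4 * 16 *
      (t ^ (-(2 * β)) * (r ^ (-(3 * β)) * |r - √(|(x j : ℝ)| / 2 / t)| ^ (-β))) := by
    intro j
    have h2 := schrodKernel_pow_mul_rpow_le hzim hzn hzre (x j) (s := t * r ^ 2) (by positivity)
      hβ0 hβ1
    have hα : √(|(x j : ℝ)| / 2 / t) ^ 2 = |(x j : ℝ)| / 2 / t := Real.sq_sqrt (by positivity)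
    have hα0 : 0 ≤ √(|(x j : ℝ)| / 2 / t) := Real.sqrt_nonneg _
    have hne := hne j
    generalize √(|(x j : ℝ)| / 2 / t) = α at *
    have h3 : t ^ 2 * r ^ 3 * |r - α| ≤ t * r ^ 2 * |t * r ^ 2 - |(x j : ℝ)| / 2| := by
      have : |(x j : ℝ)| / 2 = t * α ^ 2 := by rw [hα]; field_simp
      rw [this, show t * r ^ 2 - t * α ^ 2 = t * ((r - α) * (r + α)) by ring, abs_mul, abs_mul,
        abs_of_pos ht, abs_of_pos (by linarith : 0 < r + α)]
      have : 0 ≤ t ^ 2 * r ^ 2 * |r - α| * α := by positivity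
      nlinarith
    have h4 : 0 < |r - α| := abs_pos.2 (sub_ne_zero.2 hne)
    have h5 : (t ^ 2 * r ^ 3 * |r - α|) ^ β ≤ (t * r ^ 2 * |t * r ^ 2 - |(x j : ℝ)| / 2|) ^ β := by
      gcongr
    have h6 : (t ^ (-(2 * β)) * (r ^ (-(3 * β)) * |r - α| ^ (-β))) =
        ((t ^ 2 * r ^ 3 * |r - α|) ^ β)⁻¹ := by
      rw [Real.mul_rpow (by positivity) (by positivity), Real.mul_rpow (by positivity)
        (by positivity), ← Real.rpow_natCast, ← Real.rpow_natCast, ← Real.rpow_mul ht.le,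
        ← Real.rpow_mul hr.le, Real.rpow_neg ht.le, Real.rpow_neg hr.le, Real.rpow_neg h4.le]
      push_cast
      rw [mul_inv, mul_inv, mul_assoc]
    rw [h6, ← div_eq_mul_inv, le_div_iff₀ (by positivity)]
    exact (mul_le_mul_of_nonneg_left h5 (by positivity)).trans h2
  have h7 : ∏ j, ‖schrodKernel (x j) (z * (t * r ^ 2 : ℝ))‖ ≤
      (1 / 4) * ∑ j, ‖schrodKernel (x j) (z * (t * r ^ 2 : ℝ))‖ ^ 4 := by
    simp only [Fin.prod_univ_four, Fin.sum_univ_four]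
    generalize ‖schrodKernel (x 0) (z * (t * r ^ 2 : ℝ))‖ = a
    generalize ‖schrodKernel (x 1) (z * (t * r ^ 2 : ℝ))‖ = b
    generalize ‖schrodKernel (x 2) (z * (t * r ^ 2 : ℝ))‖ = c
    generalize ‖schrodKernel (x 3) (z * (t * r ^ 2 : ℝ))‖ = d
    nlinarith [sq_nonneg (a ^ 2 - b ^ 2), sq_nonneg (c ^ 2 - d ^ 2), sq_nonneg (a * b - c * d)]
  rw [norm_prod]
  refine h7.trans ?_
  calc (1 / 4) * ∑ j, ‖schrodKernel (x j) (z * (t * r ^ 2 : ℝ))‖ ^ 4 ≤ (1 / 4) * ∑ j,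
        18 ^ 4 * 16 * (t ^ (-(2 * β)) * (r ^ (-(3 * β)) * |r - √(|(x j : ℝ)| / 2 / t)| ^ (-β))) := by
        gcongr with j
        exact h1 j
    _ = _ := by
        rw [← Finset.mul_sum, ← Finset.mul_sum]; ring

/-- The cut-off away from the origin in the subordination variable. -/
noncomputable def outerCutoff (r : ℝ) : ℝ := 1 - max 0 (1 - 256 * r ^ 4) ^ 3

theorem continuous_outerCutoff : Continuous outerCutoff := by
  unfold outerCutoff; fun_prop

theorem outerCutoff_nonneg (r : ℝ) : 0 ≤ outerCutoff r := by
  rw [outerCutoff, sub_nonneg]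
  refine pow_le_one₀ (le_max_left _ _) (max_le zero_le_one ?_)
  have : 0 ≤ r ^ 4 := by positivity
  linarith

theorem outerCutoff_le_one (r : ℝ) : outerCutoff r ≤ 1 := by
  have : 0 ≤ max 0 (1 - 256 * r ^ 4) ^ 3 := pow_nonneg (le_max_left _ _) 3
  rw [outerCutoff]; linarith

theorem outerCutoff_le_pow (r : ℝ) : outerCutoff r ≤ 768 * r ^ 4 := by
  have hr : 0 ≤ r ^ 4 := by positivity
  rw [outerCutoff]
  rcases le_total 0 (1 - 256 * r ^ 4) with h | h
  · rw [max_eq_right h]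
    have := mul_nonneg (sq_nonneg (256 * r ^ 4)) (by linarith : 0 ≤ 3 - 256 * r ^ 4)
    linear_combination this
  · rw [max_eq_left h]; norm_num; linarith

theorem exists_majorant_outerCutoff {β : ℝ} (hβ : 1 / 3 < β) (hβ1 : β < 1) :
    ∃ C : ℝ, 0 < C ∧ ∀ α : ℝ, ∃ h : ℝ → ℝ, IntegrableOn h (Set.Ioi 0) ∧
      ∫ r in Set.Ioi 0, h r ≤ C ∧ ∀ r, 0 < r →
        outerCutoff r * (r ^ (-(3 * β)) * |r - α| ^ (-β)) ≤ h r := by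
  set m : ℝ → ℝ := fun r => if r ≤ 1 then 1 else r ^ (-(3 * β)) with hm
  set f : ℝ → ℝ := (Set.Icc (-1) 1).indicator fun x => |x| ^ (-β) with hf
  have hf0 : ∀ x, 0 ≤ f x := fun x => Set.indicator_nonneg (fun x _ => by positivity) x
  have hfi : Integrable f := by
    rw [hf, integrable_indicator_iff measurableSet_Icc, integrableOn_Icc_iff_integrableOn_Ioc,
      ← intervalIntegrable_iff_integrableOn_Ioc_of_le (by norm_num)]
    have h2 : IntervalIntegrable (fun x : ℝ => |x| ^ (-β)) volume 0 1 := by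
      refine (intervalIntegral.intervalIntegrable_rpow' (r := -β) (by linarith)).congr ?_
      intro x hx
      rw [Set.uIoc_of_le zero_le_one] at hx
      simp only
      rw [abs_of_pos hx.1]
    have h3 : IntervalIntegrable (fun x : ℝ => |x| ^ (-β)) volume (-1) 0 := by
      rw [IntervalIntegrable.iff_comp_neg]; simpa using h2.symm
    exact h3.trans h2
  have hmi : IntegrableOn m (Set.Ioi 0) := by
    rw [← Set.Ioc_union_Ioi_eq_Ioi zero_le_one]
    refine IntegrableOn.union ?_ ?_
    · refine (integrableOn_const (C := (1 : ℝ)) (by simp)).congr_fun (fun r hr => ?_)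
        measurableSet_Ioc
      simp [hm, hr.2]
    · refine (integrableOn_Ioi_rpow_of_lt (a := -(3 * β)) (by linarith) zero_lt_one).congr_fun
        (fun r hr => ?_) measurableSet_Ioi
      simp [hm, not_le.2 (Set.mem_Ioi.1 hr)]
  refine ⟨max 1 (768 * ((∫ r in Set.Ioi 0, m r) + ∫ x, f x)), by positivity, fun α =>
    ⟨fun r => 768 * (m r + f (r - α)), ?_, ?_, ?_⟩⟩
  · exact (hmi.add (hfi.comp_sub_right α).integrableOn).const_mul _
  · refine le_trans ?_ (le_max_right _ _)
    rw [integral_const_mul, integral_add hmi (hfi.comp_sub_right α).integrableOn]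
    gcongr
    refine (setIntegral_le_integral (hfi.comp_sub_right α)
      (Filter.Eventually.of_forall fun x => hf0 _)).trans_eq ?_
    exact integral_sub_right_eq_self f α
  · intro r hr
    have hρ0 := outerCutoff_nonneg r
    have h1 : outerCutoff r * r ^ (-(3 * β)) ≤ 768 * m r ∧
        outerCutoff r * r ^ (-(3 * β)) ≤ 768 := by
      by_cases h : r ≤ 1
      · have : outerCutoff r * r ^ (-(3 * β)) ≤ 768 := by
          calc outerCutoff r * r ^ (-(3 * β)) ≤ 768 * r ^ 4 * r ^ (-(3 * β)) := by
                gcongr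
                exact outerCutoff_le_pow r
            _ = 768 * r ^ (4 - 3 * β) := by
                rw [mul_assoc, ← Real.rpow_natCast, ← Real.rpow_add hr]
                norm_num [sub_eq_add_neg]
            _ ≤ 768 * 1 := by
                gcongr
                exact Real.rpow_le_one hr.le h (by linarith)
            _ = 768 := mul_one _
        simpa [hm, h] using this
      · have h3 : r ^ (-(3 * β)) ≤ 1 :=
          Real.rpow_le_one_of_one_le_of_nonpos (not_le.1 h).le (by linarith)
        have h4 : 0 < r ^ (-(3 * β)) := by positivity
        have h5 := outerCutoff_le_one r
        simp only [hm, h, if_false]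
        constructor <;> nlinarith
    have hm0 : 0 ≤ m r := by
      simp only [hm]; split_ifs <;> positivity
    show _ ≤ 768 * (m r + f (r - α))
    rw [← mul_assoc]
    by_cases h : r - α ∈ Set.Icc (-1 : ℝ) 1
    · have : f (r - α) = |r - α| ^ (-β) := Set.indicator_of_mem h _
      rw [this]
      have h6 : 0 ≤ |r - α| ^ (-β) := by positivity
      nlinarith [mul_le_mul_of_nonneg_right h1.2 h6]
    · have h7 : 1 ≤ |r - α| := by
        rw [Set.mem_Icc, ← abs_le] at h
        exact (not_le.1 h).le
      have h8 : |r - α| ^ (-β) ≤ 1 := Real.rpow_le_one_of_one_le_of_nonpos h7 (by linarith)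
      have h9 : 0 ≤ outerCutoff r * r ^ (-(3 * β)) := by positivity
      nlinarith [hf0 (r - α), h1.1]

theorem integrable_prod_gaussian_discOmega {b : ℝ} (hb : 0 < b) :
    Integrable (fun q : (Fin 4 → ℝ) × ℝ => Real.exp (-(b * discOmega 4 q.1 ^ 2) * q.2 ^ 2))
      ((volume.restrict (torusBox 4)).prod (volume.restrict (Set.Ioi 0))) := by
  have hω := continuous_discOmega 4
  have hm : AEStronglyMeasurable
      (fun q : (Fin 4 → ℝ) × ℝ => Real.exp (-(b * discOmega 4 q.1 ^ 2) * q.2 ^ 2))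
      ((volume.restrict (torusBox 4)).prod (volume.restrict (Set.Ioi 0))) :=
    (by fun_prop : Continuous fun q : (Fin 4 → ℝ) × ℝ =>
      Real.exp (-(b * discOmega 4 q.1 ^ 2) * q.2 ^ 2)).aestronglyMeasurable
  rw [integrable_prod_iff hm]
  constructor
  · filter_upwards [ae_discOmega_pos] with ξ hξ
    exact (integrable_exp_neg_mul_sq (by positivity)).integrableOn
  · refine (integrableOn_inv_discOmega.const_mul (√(Real.pi / b) / 2)).congr ?_
    filter_upwards [ae_discOmega_pos] with ξ hξ
    simp only [Real.norm_eq_abs, Real.abs_exp]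
    rw [integral_gaussian_Ioi, ← div_div, Real.sqrt_div' _ (sq_nonneg _), Real.sqrt_sq hξ.le]
    ring

theorem exists_norm_integral_outer_le {β : ℝ} (hβ : 1 / 3 < β) (hβ1 : β < 1) :
    ∃ C : ℝ, 0 < C ∧ ∀ (z : ℂ) (t : ℝ) (x : Fin 4 → ℤ), z.im = 1 → ‖z‖ ≤ 2 → z.re < 0 → 0 < t →
      IntegrableOn (fun ξ => cexp (I * ((∑ j, (x j : ℝ) * ξ j : ℝ) : ℂ)) *
        ∫ r in Set.Ioi (0 : ℝ), (outerCutoff r : ℂ) *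
          cexp (z * t * ((discOmega 4 ξ : ℂ) ^ 2 * (r : ℂ) ^ 2 + 1 / (4 * (r : ℂ) ^ 2))))
        (torusBox 4) ∧
      ‖∫ ξ in torusBox 4, cexp (I * ((∑ j, (x j : ℝ) * ξ j : ℝ) : ℂ)) *
        ∫ r in Set.Ioi (0 : ℝ), (outerCutoff r : ℂ) *
          cexp (z * t * ((discOmega 4 ξ : ℂ) ^ 2 * (r : ℂ) ^ 2 + 1 / (4 * (r : ℂ) ^ 2)))‖ ≤
        C * t ^ (-(2 * β)) := by
  obtain ⟨C, hC, hmaj⟩ := exists_majorant_outerCutoff hβ hβ1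
  refine ⟨18 ^ 4 * 4 * (4 * C), by positivity, fun z t x hzim hzn hzre ht => ?_⟩
  have hω := continuous_discOmega 4
  have hωm := hω.measurable
  have hρm := continuous_outerCutoff.measurable
  set F : (Fin 4 → ℝ) → ℝ → ℂ := fun ξ r => cexp (I * ((∑ j, (x j : ℝ) * ξ j : ℝ) : ℂ)) *
    ((outerCutoff r : ℂ) *
      cexp (z * t * ((discOmega 4 ξ : ℂ) ^ 2 * (r : ℂ) ^ 2 + 1 / (4 * (r : ℂ) ^ 2)))) with hF
  have hFi : Integrable (Function.uncurry F)
      ((volume.restrict (torusBox 4)).prod (volume.restrict (Set.Ioi 0))) := by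
    have hb : 0 < -z.re * t := mul_pos (by linarith) ht
    refine (integrable_prod_gaussian_discOmega hb).mono' ?_
      (Filter.Eventually.of_forall fun q => ?_)
    · have : Measurable (Function.uncurry F) := by
        simp only [hF, Function.uncurry_def]
        fun_prop
      exact this.aestronglyMeasurable
    · simp only [hF, Function.uncurry_def]
      rw [norm_mul, norm_mul, mul_comm I, Complex.norm_exp_ofReal_mul_I, one_mul, Complex.norm_real,
        Real.norm_of_nonneg (outerCutoff_nonneg _), Complex.norm_exp]
      refine (mul_le_of_le_one_left (Real.exp_pos _).le (outerCutoff_le_one _)).trans ?_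
      rw [Real.exp_le_exp]
      have h1 : (z * t * ((discOmega 4 q.1 : ℂ) ^ 2 * (q.2 : ℂ) ^ 2 + 1 / (4 * (q.2 : ℂ) ^ 2))).re =
          z.re * t * (discOmega 4 q.1 ^ 2 * q.2 ^ 2 + 1 / (4 * q.2 ^ 2)) := by
        rw [show z * t * ((discOmega 4 q.1 : ℂ) ^ 2 * (q.2 : ℂ) ^ 2 + 1 / (4 * (q.2 : ℂ) ^ 2)) =
          z * ((t * (discOmega 4 q.1 ^ 2 * q.2 ^ 2 + 1 / (4 * q.2 ^ 2)) : ℝ) : ℂ) by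
            push_cast; ring, Complex.re_mul_ofReal]
        ring
      rw [h1]
      have h2 : 0 ≤ -z.re * t * (1 / (4 * q.2 ^ 2)) := by positivity
      nlinarith
  have hswap := integral_integral_swap hFi
  have hinner : ∀ r : ℝ, ∫ ξ in torusBox 4, F ξ r = (outerCutoff r : ℂ) *
      cexp (z * t * (1 / (4 * (r : ℂ) ^ 2))) * ∏ j, schrodKernel (x j) (z * (t * r ^ 2 : ℝ)) := by
    intro r
    rw [← setIntegral_torusBox_eq_prod_schrodKernel, ← integral_const_mul]
    congr 1 with ξ
    simp only [hF]
    rw [mul_add, Complex.exp_add, show z * t * ((discOmega 4 ξ : ℂ) ^ 2 * (r : ℂ) ^ 2) =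
      z * (t * r ^ 2 : ℝ) * (discOmega 4 ξ ^ 2 : ℝ) by push_cast; ring]
    ring
  choose h hhi hhC hh using fun j : Fin 4 => hmaj √(|(x j : ℝ)| / 2 / t)
  have hfun : (fun ξ : Fin 4 → ℝ => ∫ r in Set.Ioi (0 : ℝ), F ξ r) = fun ξ =>
      cexp (I * ((∑ j, (x j : ℝ) * ξ j : ℝ) : ℂ)) *
        ∫ r in Set.Ioi (0 : ℝ), (outerCutoff r : ℂ) *
          cexp (z * t * ((discOmega 4 ξ : ℂ) ^ 2 * (r : ℂ) ^ 2 + 1 / (4 * (r : ℂ) ^ 2))) :=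
    funext fun ξ => integral_const_mul _ _
  refine ⟨hfun ▸ hFi.integral_prod_left, ?_⟩
  rw [← hfun, hswap]
  simp only [hinner]
  have hb : ∀ᵐ r ∂(volume.restrict (Set.Ioi (0 : ℝ))), ‖(outerCutoff r : ℂ) *
      cexp (z * t * (1 / (4 * (r : ℂ) ^ 2))) * ∏ j, schrodKernel (x j) (z * (t * r ^ 2 : ℝ))‖ ≤
      18 ^ 4 * 4 * t ^ (-(2 * β)) * ∑ j, h j r := by
    have hne : ∀ᵐ r : ℝ, ∀ j : Fin 4, r ≠ √(|(x j : ℝ)| / 2 / t) :=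
      ae_all_iff.2 fun j => Measure.ae_ne volume _
    filter_upwards [ae_restrict_mem measurableSet_Ioi, ae_restrict_of_ae hne] with r hr hr'
    have hr : 0 < r := hr
    have h1 := prod_schrodKernel_le hzim hzn hzre.le x ht hr (by linarith) hβ1.le hr'
    have h2 : ‖cexp (z * t * (1 / (4 * (r : ℂ) ^ 2)))‖ ≤ 1 := by
      rw [Complex.norm_exp, Real.exp_le_one_iff,
        show z * t * (1 / (4 * (r : ℂ) ^ 2)) = z * ((t * (1 / (4 * r ^ 2)) : ℝ) : ℂ) by
          push_cast; ring, Complex.re_mul_ofReal]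
      exact mul_nonpos_of_nonpos_of_nonneg hzre.le (by positivity)
    have h3 := outerCutoff_nonneg r
    rw [norm_mul, norm_mul, Complex.norm_real, Real.norm_of_nonneg h3]
    calc outerCutoff r * ‖cexp (z * t * (1 / (4 * (r : ℂ) ^ 2)))‖ *
          ‖∏ j, schrodKernel (x j) (z * (t * r ^ 2 : ℝ))‖ ≤
          outerCutoff r * 1 * (18 ^ 4 * 4 * t ^ (-(2 * β)) *
      ∑ j, r ^ (-(3 * β)) * |r - √(|(x j : ℝ)| / 2 / t)| ^ (-β)) := by gcongr
      _ = 18 ^ 4 * 4 * t ^ (-(2 * β)) *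
        ∑ j, outerCutoff r * (r ^ (-(3 * β)) * |r - √(|(x j : ℝ)| / 2 / t)| ^ (-β)) := by
          simp only [← Finset.mul_sum]; ring
      _ ≤ _ := by
          gcongr with j
          exact hh j r hr
  have hsum : Integrable (fun r => ∑ j, h j r) (volume.restrict (Set.Ioi (0 : ℝ))) :=
    integrable_finsetSum _ fun j _ => hhi j
  refine (norm_integral_le_of_norm_le (hsum.const_mul _) hb).trans ?_
  rw [integral_const_mul, integral_finsetSum _ fun j _ => hhi j]
  calc 18 ^ 4 * 4 * t ^ (-(2 * β)) * ∑ j, ∫ r in Set.Ioi 0, h j r ≤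
        18 ^ 4 * 4 * t ^ (-(2 * β)) * ∑ _j : Fin 4, C := by
        gcongr with j
        exact hhC j
    _ = _ := by simp; ring

theorem exists_norm_integral_sub_outer_le :
    ∃ C : ℝ, 0 < C ∧ ∀ (z : ℂ) (t w : ℝ), z.im = 1 → z.re < 0 → 0 < t → 0 < w → w ^ 2 ≤ 16 →
      ‖(∫ r in Set.Ioi (0 : ℝ), cexp (z * t * ((w : ℂ) ^ 2 * (r : ℂ) ^ 2 + 1 / (4 * (r : ℂ) ^ 2)))) -
        ∫ r in Set.Ioi (0 : ℝ), (outerCutoff r : ℂ) *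
          cexp (z * t * ((w : ℂ) ^ 2 * (r : ℂ) ^ 2 + 1 / (4 * (r : ℂ) ^ 2)))‖ ≤ C / t ^ 2 := by
  obtain ⟨C, hC, hb⟩ := exists_norm_integral_nonstationary_le
  refine ⟨C, hC, fun z t w hzim hzre ht hw hw4 => ?_⟩
  have hK := (integral_exp_subordination hzre ht hw).1
  have hρK : IntegrableOn (fun r : ℝ => (outerCutoff r : ℂ) *
      cexp (z * t * ((w : ℂ) ^ 2 * (r : ℂ) ^ 2 + 1 / (4 * (r : ℂ) ^ 2)))) (Set.Ioi 0) := by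
    refine hK.bdd_mul (c := 1) (Complex.continuous_ofReal.comp
      continuous_outerCutoff).aestronglyMeasurable (Filter.Eventually.of_forall fun r => ?_)
    simpa [abs_of_nonneg (outerCutoff_nonneg r)] using outerCutoff_le_one r
  have hτ : (z * t).re ≤ 0 := by
    rw [Complex.re_mul_ofReal]; exact mul_nonpos_of_nonpos_of_nonneg hzre.le ht.le
  have hz1 : 1 ≤ ‖z‖ := by
    have := Complex.abs_im_le_norm z
    rwa [hzim, abs_one] at this
  have hτn : t ≤ ‖z * t‖ := by
    rw [norm_mul, Complex.norm_real, Real.norm_of_nonneg ht.le]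
    exact le_mul_of_one_le_left ht.le hz1
  have h1 := hb (w ^ 2) ⟨by positivity, hw4⟩ (z * t) (norm_pos_iff.1 (ht.trans_le hτn)) hτ
  rw [← integral_sub hK hρK]
  have h2 : ∫ r in Set.Ioi (0 : ℝ), (cexp (z * t * ((w : ℂ) ^ 2 * (r : ℂ) ^ 2 + 1 / (4 * (r : ℂ) ^ 2)))
      - (outerCutoff r : ℂ) *
        cexp (z * t * ((w : ℂ) ^ 2 * (r : ℂ) ^ 2 + 1 / (4 * (r : ℂ) ^ 2)))) =
      ∫ r in (0 : ℝ)..1 / 4, ((1 - 256 * r ^ 4) ^ 3 : ℝ) *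
        cexp (z * t * ((w ^ 2 : ℝ) * r ^ 2 + 1 / (4 * r ^ 2) : ℝ)) := by
    rw [intervalIntegral.integral_of_le (by norm_num)]
    symm
    rw [← integral_indicator measurableSet_Ioc, ← integral_indicator measurableSet_Ioi]
    congr 1 with r
    by_cases hr : 0 < r
    · rw [Set.indicator_of_mem (Set.mem_Ioi.2 hr)]
      by_cases hr4 : r ≤ 1 / 4
      · rw [Set.indicator_of_mem (Set.mem_Ioc.2 ⟨hr, hr4⟩)]
        have : r ^ 4 ≤ (1 / 4) ^ 4 := pow_le_pow_left₀ hr.le hr4 4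
        rw [outerCutoff, max_eq_right (by norm_num at this; linarith)]
        push_cast
        ring
      · rw [Set.indicator_of_notMem (fun h => hr4 h.2)]
        have : (1 / 4) ^ 4 ≤ r ^ 4 := pow_le_pow_left₀ (by norm_num) (not_le.1 hr4).le 4
        rw [outerCutoff, max_eq_left (by norm_num at this; linarith)]
        simp
    · rw [Set.indicator_of_notMem (fun h => hr h.1), Set.indicator_of_notMem (mt Set.mem_Ioi.1 hr)]
  rw [h2]
  refine h1.trans ?_
  gcongr

theorem norm_exp_mul_exp_div_discOmega_le {z : ℂ} (hzre : z.re ≤ 0) {t : ℝ} (ht : 0 ≤ t)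
    (x : Fin 4 → ℤ) (ξ : Fin 4 → ℝ) : ‖cexp (I * ((∑ j, (x j : ℝ) * ξ j : ℝ) : ℂ)) *
      (cexp (z * t * discOmega 4 ξ) / discOmega 4 ξ)‖ ≤ (discOmega 4 ξ)⁻¹ := by
  have := discOmega_nonneg 4 ξ
  rw [norm_mul, mul_comm I, Complex.norm_exp_ofReal_mul_I, one_mul, norm_div, Complex.norm_real,
    Real.norm_of_nonneg this, ← one_div]
  gcongr
  rw [Complex.norm_exp, Real.exp_le_one_iff, mul_assoc, ← Complex.ofReal_mul, Complex.re_mul_ofReal]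
  exact mul_nonpos_of_nonpos_of_nonneg hzre (by positivity)

theorem integrableOn_exp_mul_exp_div_discOmega {z : ℂ} (hzre : z.re ≤ 0) {t : ℝ} (ht : 0 ≤ t)
    (x : Fin 4 → ℤ) : IntegrableOn (fun ξ => cexp (I * ((∑ j, (x j : ℝ) * ξ j : ℝ) : ℂ)) *
      (cexp (z * t * discOmega 4 ξ) / discOmega 4 ξ)) (torusBox 4) := by
  have hω := (continuous_discOmega 4).measurable
  exact integrableOn_inv_discOmega.mono' (Measurable.aestronglyMeasurable (by fun_prop))
    (Filter.Eventually.of_forall (norm_exp_mul_exp_div_discOmega_le hzre ht x))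

theorem exists_norm_integral_damped_le {β : ℝ} (hβ : 1 / 3 < β) (hβ1 : β < 1) :
    ∃ C : ℝ, 0 < C ∧ ∀ (z : ℂ) (t : ℝ) (x : Fin 4 → ℤ), z.im = 1 → ‖z‖ ≤ 2 → z.re < 0 → 1 ≤ t →
      ‖∫ ξ in torusBox 4, cexp (I * ((∑ j, (x j : ℝ) * ξ j : ℝ) : ℂ)) *
        (cexp (z * t * discOmega 4 ξ) / discOmega 4 ξ)‖ ≤ C * t ^ (1 / 2 - 2 * β) := by
  obtain ⟨C, hC, hout⟩ := exists_norm_integral_outer_le hβ hβ1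
  obtain ⟨D, hD, hin⟩ := exists_norm_integral_sub_outer_le
  have hV0 : 0 ≤ volume.real (torusBox 4) := measureReal_nonneg
  refine ⟨2 * (C + D * volume.real (torusBox 4)), by positivity,
    fun z t x hzim hzn hzre ht1 => ?_⟩
  have ht : 0 < t := by linarith
  obtain ⟨hoi, ho⟩ := hout z t x hzim hzn hzre ht
  set c : ℂ := (Real.pi / (-z)) ^ (1 / 2 : ℂ) with hc
  have hz0 : 0 < ‖z‖ := by
    have := Complex.abs_im_le_norm z
    rw [hzim, abs_one] at this
    linarith
  have hcn : 1 ≤ ‖c‖ := by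
    have h1 : c ^ 2 = Real.pi / (-z) := by
      simp [hc]
    have h2 : ‖c‖ ^ 2 = Real.pi / ‖z‖ := by
      rw [← norm_pow, h1, norm_div, norm_neg, Complex.norm_real, Real.norm_of_nonneg Real.pi_pos.le]
    have h3 : 1 ≤ Real.pi / ‖z‖ := by
      rw [le_div_iff₀ hz0]; linarith [Real.pi_gt_three]
    have h4 := norm_nonneg c
    nlinarith
  have hEi := integrableOn_exp_mul_exp_div_discOmega hzre.le ht.le x
  have hE := hEi.const_mul c
  have hO := hoi.const_mul (2 * √t : ℂ)
  have hdiff : ‖(∫ ξ in torusBox 4, c * (cexp (I * ((∑ j, (x j : ℝ) * ξ j : ℝ) : ℂ)) *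
        (cexp (z * t * discOmega 4 ξ) / discOmega 4 ξ))) -
      ∫ ξ in torusBox 4, (2 * √t : ℂ) * (cexp (I * ((∑ j, (x j : ℝ) * ξ j : ℝ) : ℂ)) *
        ∫ r in Set.Ioi (0 : ℝ), (outerCutoff r : ℂ) *
          cexp (z * t * ((discOmega 4 ξ : ℂ) ^ 2 * (r : ℂ) ^ 2 + 1 / (4 * (r : ℂ) ^ 2))))‖ ≤
      2 * √t * (D / t ^ 2) * volume.real (torusBox 4) := by
    rw [← integral_sub hE hO]
    refine norm_setIntegral_le_of_norm_le_const_ae (volume_torusBox_lt_top 4) ?_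
    filter_upwards [ae_discOmega_pos] with ξ hξ
    have h1 := (integral_exp_subordination hzre ht hξ).2
    rw [show c * (cexp (I * ((∑ j, (x j : ℝ) * ξ j : ℝ) : ℂ)) *
      (cexp (z * t * discOmega 4 ξ) / discOmega 4 ξ)) =
      cexp (I * ((∑ j, (x j : ℝ) * ξ j : ℝ) : ℂ)) *
      (c * (cexp (z * t * discOmega 4 ξ) / discOmega 4 ξ)) by ring, h1, mul_left_comm, ← mul_sub,
      ← mul_sub, norm_mul, mul_comm I]
    have h2 : ‖(2 * √t : ℂ)‖ = 2 * √t := by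
      rw [norm_mul, Complex.norm_real, Real.norm_of_nonneg (Real.sqrt_nonneg _)]; norm_num
    rw [h2, norm_mul, Complex.norm_exp_ofReal_mul_I, one_mul]
    gcongr
    exact hin z t _ hzim hzre ht hξ (discOmega_four_sq_le ξ)
  rw [integral_const_mul, integral_const_mul] at hdiff
  set E := ∫ ξ in torusBox 4, cexp (I * ((∑ j, (x j : ℝ) * ξ j : ℝ) : ℂ)) *
        (cexp (z * t * discOmega 4 ξ) / discOmega 4 ξ) with hEdef
  set O := ∫ ξ in torusBox 4, (cexp (I * ((∑ j, (x j : ℝ) * ξ j : ℝ) : ℂ)) *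
        ∫ r in Set.Ioi (0 : ℝ), (outerCutoff r : ℂ) *
          cexp (z * t * ((discOmega 4 ξ : ℂ) ^ 2 * (r : ℂ) ^ 2 + 1 / (4 * (r : ℂ) ^ 2)))) with hOdef
  have h2 : ‖(2 * √t : ℂ) * O‖ ≤ 2 * √t * (C * t ^ (-(2 * β))) := by
    rw [norm_mul, norm_mul, Complex.norm_real, Real.norm_of_nonneg (Real.sqrt_nonneg _)]
    norm_num
    gcongr
  have h3 : D / t ^ 2 ≤ D * t ^ (-(2 * β)) := by
    rw [div_eq_mul_inv]
    gcongr
    rw [← Real.rpow_natCast, ← Real.rpow_neg ht.le]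
    exact Real.rpow_le_rpow_of_exponent_le ht1 (by push_cast; linarith)
  calc ‖E‖ ≤ ‖c * E‖ := by
        rw [norm_mul]; exact le_mul_of_one_le_left (norm_nonneg _) hcn
    _ ≤ ‖c * E - (2 * √t : ℂ) * O‖ + ‖(2 * √t : ℂ) * O‖ := norm_le_norm_sub_add _ _
    _ ≤ 2 * √t * (D * t ^ (-(2 * β))) * volume.real (torusBox 4) + 2 * √t * (C * t ^ (-(2 * β))) := by
        refine add_le_add (hdiff.trans ?_) h2
        gcongr
    _ = 2 * (C + D * volume.real (torusBox 4)) * (√t * t ^ (-(2 * β))) := by ring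
    _ = _ := by
        rw [Real.sqrt_eq_rpow, ← Real.rpow_add ht, sub_eq_add_neg]

theorem exists_norm_integral_halfWave_le {β : ℝ} (hβ : 1 / 3 < β) (hβ1 : β < 1) :
    ∃ C : ℝ, 0 < C ∧ ∀ (t : ℝ) (x : Fin 4 → ℤ), 1 ≤ t →
      ‖∫ ξ in torusBox 4, cexp (I * ((∑ j, (x j : ℝ) * ξ j : ℝ) : ℂ)) *
        (cexp (I * t * discOmega 4 ξ) / discOmega 4 ξ)‖ ≤ C * t ^ (1 / 2 - 2 * β) := by
  obtain ⟨C, hC, hd⟩ := exists_norm_integral_damped_le hβ hβ1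
  refine ⟨C, hC, fun t x ht => ?_⟩
  have hω := (continuous_discOmega 4).measurable
  set z : ℕ → ℂ := fun n => I - ((1 / ((n : ℝ) + 1) : ℝ) : ℂ) with hz
  have hn : ∀ n : ℕ, 0 < 1 / ((n : ℝ) + 1) ∧ 1 / ((n : ℝ) + 1) ≤ 1 := fun n =>
    ⟨by positivity, by rw [div_le_one (by positivity)]; linarith [Nat.cast_nonneg (α := ℝ) n]⟩
  have hzre : ∀ n, (z n).re < 0 := fun n => by
    have := (hn n).1
    simp only [hz, Complex.sub_re, Complex.I_re, Complex.ofReal_re]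
    linarith
  have hzim : ∀ n, (z n).im = 1 := fun n => by
    simp only [hz, Complex.sub_im, Complex.I_im, Complex.ofReal_im, sub_zero]
  have hzn : ∀ n, ‖z n‖ ≤ 2 := fun n => by
    refine (norm_sub_le _ _).trans ?_
    rw [Complex.norm_I, Complex.norm_real, Real.norm_of_nonneg (hn n).1.le]
    linarith [(hn n).2]
  have hzlim : Filter.Tendsto z Filter.atTop (nhds I) := by
    have h1 := (Complex.continuous_ofReal.tendsto 0).comp
      (tendsto_one_div_add_atTop_nhds_zero_nat (𝕜 := ℝ))
    simpa [hz] using (tendsto_const_nhds (x := I)).sub h1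
  have hlim : Filter.Tendsto (fun n => ∫ ξ in torusBox 4,
      cexp (I * ((∑ j, (x j : ℝ) * ξ j : ℝ) : ℂ)) *
        (cexp (z n * t * discOmega 4 ξ) / discOmega 4 ξ)) Filter.atTop
      (nhds (∫ ξ in torusBox 4, cexp (I * ((∑ j, (x j : ℝ) * ξ j : ℝ) : ℂ)) *
        (cexp (I * t * discOmega 4 ξ) / discOmega 4 ξ))) := by
    refine tendsto_integral_of_dominated_convergence (fun ξ => (discOmega 4 ξ)⁻¹)
      (fun n => (integrableOn_exp_mul_exp_div_discOmega (hzre n).le (by linarith) x).1)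
      integrableOn_inv_discOmega (fun n => Filter.Eventually.of_forall fun ξ => ?_)
      (Filter.Eventually.of_forall fun ξ => ?_)
    · exact norm_exp_mul_exp_div_discOmega_le (hzre n).le (by linarith) x ξ
    · exact (((Complex.continuous_exp.tendsto _).comp
        ((hzlim.mul_const _).mul_const _)).div_const _).const_mul _
  exact le_of_tendsto hlim.norm (Filter.Eventually.of_forall fun n =>
    hd (z n) t x (hzim n) (hzn n) (hzre n) ht)

theorem norm_exp_mul_sin_div_discOmega_le (x : Fin 4 → ℤ) (t : ℝ) (ξ : Fin 4 → ℝ) :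
    ‖cexp (I * ((∑ j, (x j : ℝ) * ξ j : ℝ) : ℂ)) *
      ((Real.sin (t * discOmega 4 ξ) / discOmega 4 ξ : ℝ) : ℂ)‖ ≤ (discOmega 4 ξ)⁻¹ := by
  have := discOmega_nonneg 4 ξ
  rw [norm_mul, mul_comm I, Complex.norm_exp_ofReal_mul_I, one_mul, Complex.norm_real, norm_div,
    Real.norm_of_nonneg this, ← one_div]
  gcongr
  exact Real.abs_sin_le_one _

theorem integrableOn_exp_mul_sin_div_discOmega (x : Fin 4 → ℤ) (t : ℝ) :
    IntegrableOn (fun ξ => cexp (I * ((∑ j, (x j : ℝ) * ξ j : ℝ) : ℂ)) *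
      ((Real.sin (t * discOmega 4 ξ) / discOmega 4 ξ : ℝ) : ℂ)) (torusBox 4) := by
  have hω := (continuous_discOmega 4).measurable
  exact integrableOn_inv_discOmega.mono' (Measurable.aestronglyMeasurable (by fun_prop))
    (Filter.Eventually.of_forall (norm_exp_mul_sin_div_discOmega_le x t))

theorem greenG_neg (d : ℕ) (x : Fin d → ℤ) (t : ℝ) : greenG d x (-t) = -greenG d x t := by
  simp only [greenG, neg_mul, Real.sin_neg, neg_div, Complex.ofReal_neg, mul_neg, integral_neg,
    Complex.neg_re]

theorem inv_two_pi_pow_eq : ((2 * Real.pi : ℂ) ^ 4)⁻¹ = (((2 * Real.pi) ^ 4)⁻¹ : ℝ) := by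
  push_cast; ring

theorem inv_two_pi_pow_le_one : ((2 * Real.pi) ^ 4)⁻¹ ≤ 1 :=
  inv_le_one_of_one_le₀ (one_le_pow₀ (by linarith [Real.pi_gt_three]))

theorem abs_greenG_le (x : Fin 4 → ℤ) (t : ℝ) :
    |greenG 4 x t| ≤ ∫ ξ in torusBox 4, (discOmega 4 ξ)⁻¹ := by
  have h1 := norm_integral_le_of_norm_le integrableOn_inv_discOmega
    (Filter.Eventually.of_forall (norm_exp_mul_sin_div_discOmega_le x t))
  rw [greenG, inv_two_pi_pow_eq, Complex.re_ofReal_mul, abs_mul,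
    abs_of_nonneg (a := ((2 * Real.pi) ^ 4)⁻¹) (by have := Real.pi_pos; positivity)]
  exact (mul_le_of_le_one_left (abs_nonneg _) inv_two_pi_pow_le_one).trans
    ((Complex.abs_re_le_norm _).trans h1)

theorem greenG_eq_im_halfWave (x : Fin 4 → ℤ) {t : ℝ} (ht : 0 ≤ t) :
    greenG 4 x t = ((2 * Real.pi) ^ 4)⁻¹ *
      (((∫ ξ in torusBox 4, cexp (I * ((∑ j, (x j : ℝ) * ξ j : ℝ) : ℂ)) *
        (cexp (I * t * discOmega 4 ξ) / discOmega 4 ξ)) +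
      ∫ ξ in torusBox 4, cexp (I * ((∑ j, ((-x) j : ℤ) * ξ j : ℝ) : ℂ)) *
        (cexp (I * t * discOmega 4 ξ) / discOmega 4 ξ)).im / 2) := by
  have h1 := integrableOn_exp_mul_exp_div_discOmega (z := I) (by simp) ht x
  have h2 := integrableOn_exp_mul_exp_div_discOmega (z := I) (by simp) ht (-x)
  rw [greenG, inv_two_pi_pow_eq, Complex.re_ofReal_mul, ← integral_add h1 h2]
  congr 1
  have e1 : ∀ f : (Fin 4 → ℝ) → ℂ, IntegrableOn f (torusBox 4) →
      (∫ ξ in torusBox 4, f ξ).re = ∫ ξ in torusBox 4, (f ξ).re := fun f hf =>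
    (integral_re (𝕜 := ℂ) hf).symm
  have e2 : ∀ f : (Fin 4 → ℝ) → ℂ, IntegrableOn f (torusBox 4) →
      (∫ ξ in torusBox 4, f ξ).im = ∫ ξ in torusBox 4, (f ξ).im := fun f hf =>
    (integral_im (𝕜 := ℂ) hf).symm
  have h12 := e2 _ (h1.add h2)
  simp only [Pi.add_apply] at h12
  rw [e1 _ (integrableOn_exp_mul_sin_div_discOmega x t), h12, ← integral_div]
  congr 1 with ξ
  have h3 : ((∑ j, ((-x) j : ℤ) * ξ j : ℝ) : ℂ) = -((∑ j, (x j : ℝ) * ξ j : ℝ) : ℂ) := by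
    simp
  rw [h3]
  generalize (∑ j, (x j : ℝ) * ξ j) = a
  rw [show I * (t : ℂ) * (discOmega 4 ξ : ℂ) = ((t * discOmega 4 ξ : ℝ) : ℂ) * I by
    push_cast; ring, show I * (a : ℂ) = (a : ℂ) * I by ring,
    show I * -(a : ℂ) = ((-a : ℝ) : ℂ) * I by push_cast; ring]
  generalize t * discOmega 4 ξ = b
  generalize discOmega 4 ξ = w
  simp only [Complex.add_im, Complex.mul_im, Complex.mul_re, Complex.exp_ofReal_mul_I_re,
    Complex.exp_ofReal_mul_I_im, Complex.div_ofReal_im, Complex.div_ofReal_re, Complex.ofReal_re,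
    Complex.ofReal_im, Real.cos_neg, Real.sin_neg]
  ring

/-- The dispersive estimate for the discrete wave equation in four dimensions, with a loss. -/
theorem exists_abs_greenG_le {γ : ℝ} (hγ0 : 0 ≤ γ) (hγ : γ < 3 / 2) :
    ∃ C : ℝ, 0 < C ∧ ∀ (x : Fin 4 → ℤ) (t : ℝ), |greenG 4 x t| ≤ C * (1 + |t|) ^ (-γ) := by
  set β := max (1 / 2) ((γ + 1 / 2) / 2) with hβ
  have hβγ : (γ + 1 / 2) / 2 ≤ β := le_max_right _ _
  obtain ⟨C, hC, hh⟩ := exists_norm_integral_halfWave_le (β := β)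
    (lt_of_lt_of_le (by norm_num) (le_max_left _ _)) (max_lt (by norm_num) (by linarith))
  set C0 := ∫ ξ in torusBox 4, (discOmega 4 ξ)⁻¹ with hC0
  have hC00 : 0 ≤ C0 := integral_nonneg fun ξ => inv_nonneg.2 (discOmega_nonneg 4 ξ)
  have key : ∀ (x : Fin 4 → ℤ) (t : ℝ), 0 ≤ t →
      |greenG 4 x t| ≤ (C + C0) * 2 ^ γ * (1 + t) ^ (-γ) := by
    intro x t ht
    rcases le_total 1 t with h1 | h1
    · have ht0 : 0 < t := by linarith
      have h2 : |greenG 4 x t| ≤ C * t ^ (-γ) := by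
        rw [greenG_eq_im_halfWave x ht, abs_mul, abs_of_nonneg (a := ((2 * Real.pi) ^ 4)⁻¹)
          (by have := Real.pi_pos; positivity)]
        refine (mul_le_of_le_one_left (abs_nonneg _) inv_two_pi_pow_le_one).trans ?_
        rw [abs_div, abs_two, div_le_iff₀ two_pos]
        refine (Complex.abs_im_le_norm _).trans ((norm_add_le _ _).trans ?_)
        have h3 : t ^ (1 / 2 - 2 * β) ≤ t ^ (-γ) :=
          Real.rpow_le_rpow_of_exponent_le h1 (by linarith)
        have h4 := mul_le_mul_of_nonneg_left h3 hC.le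
        linarith [hh t x h1, hh t (-x) h1]
      have h5 : t ^ (-γ) ≤ 2 ^ γ * (1 + t) ^ (-γ) := by
        rw [Real.rpow_neg ht0.le, Real.rpow_neg (by linarith), ← div_eq_mul_inv,
          le_div_iff₀ (by positivity), inv_mul_le_iff₀ (by positivity),
          ← Real.mul_rpow (by positivity) (by positivity)]
        exact Real.rpow_le_rpow (by linarith) (by linarith) hγ0
      calc |greenG 4 x t| ≤ C * (2 ^ γ * (1 + t) ^ (-γ)) := h2.trans (by gcongr)
        _ ≤ (C + C0) * (2 ^ γ * (1 + t) ^ (-γ)) := by gcongr; linarith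
        _ = _ := by ring
    · have h5 : 1 ≤ 2 ^ γ * (1 + t) ^ (-γ) := by
        rw [Real.rpow_neg (by linarith), ← div_eq_mul_inv, one_le_div (by positivity)]
        exact Real.rpow_le_rpow (by linarith) (by linarith) hγ0
      calc |greenG 4 x t| ≤ C0 * 1 := by rw [mul_one]; exact abs_greenG_le x t
        _ ≤ (C + C0) * (2 ^ γ * (1 + t) ^ (-γ)) := by gcongr; linarith
        _ = _ := by ring
  refine ⟨(C + C0) * 2 ^ γ, by positivity, fun x t => ?_⟩
  rcases le_total 0 t with h | h
  · simpa [abs_of_nonneg h] using key x t h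
  · have := key x (-t) (by linarith)
    rwa [greenG_neg, abs_neg, ← abs_of_nonpos h] at this

theorem schrodKernel_zero_right (n : ℤ) :
    schrodKernel n 0 = if n = 0 then (2 * Real.pi : ℂ) else 0 := by
  have hpi := Real.pi_pos
  simp only [schrodKernel, zero_mul, add_zero]
  rw [integral_Icc_eq_integral_Ioc, ← intervalIntegral.integral_of_le (by linarith)]
  split_ifs with h
  · subst h
    simp only [Int.cast_zero, zero_mul, mul_zero, Complex.exp_zero,
      intervalIntegral.integral_const, Complex.real_smul]
    push_cast
    ring
  · have hc : I * (n : ℂ) ≠ 0 := mul_ne_zero I_ne_zero (Int.cast_ne_zero.2 h)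
    simp only [← mul_assoc]
    rw [integral_exp_mul_complex hc, _root_.div_eq_zero_iff, sub_eq_zero]
    left
    rw [Complex.exp_eq_exp_iff_exists_int]
    exact ⟨n, by push_cast; ring⟩

noncomputable def torusChar (x : Fin 4 → ℤ) (ξ : Fin 4 → ℝ) : ℂ :=
  cexp (I * ((∑ j, (x j : ℝ) * ξ j : ℝ) : ℂ))

theorem continuous_torusChar (x : Fin 4 → ℤ) : Continuous (torusChar x) := by
  unfold torusChar; fun_prop

theorem norm_torusChar (x : Fin 4 → ℤ) (ξ : Fin 4 → ℝ) : ‖torusChar x ξ‖ = 1 := by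
  rw [torusChar, mul_comm, Complex.norm_exp_ofReal_mul_I]

theorem conj_torusChar (x : Fin 4 → ℤ) (ξ : Fin 4 → ℝ) :
    (starRingEnd ℂ) (torusChar x ξ) = torusChar (-x) ξ := by
  simp only [torusChar, ← Complex.exp_conj, map_mul, Complex.conj_I, Complex.conj_ofReal]
  congr 1
  push_cast [Pi.neg_apply]
  simp [Finset.sum_neg_distrib]

theorem torusChar_add (x y : Fin 4 → ℤ) (ξ : Fin 4 → ℝ) :
    torusChar (x + y) ξ = torusChar x ξ * torusChar y ξ := by
  simp only [torusChar, ← Complex.exp_add, Pi.add_apply]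
  congr 1
  push_cast
  simp only [add_mul, Finset.sum_add_distrib, mul_add]

theorem setIntegral_torusChar (x : Fin 4 → ℤ) :
    ∫ ξ in torusBox 4, torusChar x ξ = if x = 0 then (2 * Real.pi : ℂ) ^ 4 else 0 := by
  have h := setIntegral_torusBox_eq_prod_schrodKernel x 0
  simp only [zero_mul, Complex.exp_zero, mul_one, schrodKernel_zero_right] at h
  simp only [torusChar]
  rw [h]
  split_ifs with hx
  · subst hx; simp
  · obtain ⟨j, hj⟩ := Function.ne_iff.1 hx
    exact Finset.prod_eq_zero (Finset.mem_univ j) (if_neg hj)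

/-- Bessel's inequality for the Fourier coefficients on the torus. -/
theorem sum_norm_setIntegral_torusChar_sq_le {h : (Fin 4 → ℝ) → ℝ}
    (hm : MemLp h 2 (volume.restrict (torusBox 4))) (S : Finset (Fin 4 → ℤ)) :
    ∑ x ∈ S, ‖∫ ξ in torusBox 4, torusChar x ξ * (h ξ : ℂ)‖ ^ 2 ≤
      (2 * Real.pi) ^ 4 * ∫ ξ in torusBox 4, h ξ ^ 2 := by
  classical
  have hpi := Real.pi_pos
  set μ := (volume : Measure (Fin 4 → ℝ)).restrict (torusBox 4) with hμ
  have : IsFiniteMeasure μ := ⟨by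
    rw [hμ, Measure.restrict_apply_univ]; exact volume_torusBox_lt_top 4⟩
  set c : ℝ := ((2 * Real.pi) ^ 2)⁻¹ with hc
  have hcpos : 0 < c := by positivity
  have hv : ∀ x : Fin 4 → ℤ, MemLp (fun ξ => (c : ℂ) * torusChar (-x) ξ) 2 μ := fun x =>
    MemLp.of_bound (((continuous_torusChar (-x)).const_mul _).aestronglyMeasurable) c
      (Filter.Eventually.of_forall fun ξ => by
        rw [norm_mul, norm_torusChar, mul_one, Complex.norm_real, Real.norm_of_nonneg hcpos.le])
  have hh : MemLp (fun ξ => (h ξ : ℂ)) 2 μ := hm.ofReal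
  have hin : ∀ (x : Fin 4 → ℤ) (g : (Fin 4 → ℝ) → ℂ) (hg : MemLp g 2 μ),
      inner ℂ (hv x).toLp hg.toLp = c * ∫ ξ, torusChar x ξ * g ξ ∂μ := by
    intro x g hg
    rw [L2.inner_def, ← integral_const_mul]
    refine integral_congr_ae ?_
    filter_upwards [(hv x).coeFn_toLp, hg.coeFn_toLp] with ξ h1 h2
    rw [h1, h2, RCLike.inner_apply, map_mul, conj_torusChar, neg_neg, Complex.conj_ofReal]
    ring
  have ho : Orthonormal ℂ fun x : Fin 4 → ℤ => (hv x).toLp := by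
    rw [orthonormal_iff_ite]
    intro x y
    rw [hin x _ (hv y)]
    have : ∀ ξ, torusChar x ξ * (c * torusChar (-y) ξ) = c * torusChar (x - y) ξ := fun ξ => by
      rw [sub_eq_add_neg, torusChar_add]; ring
    simp only [this]
    rw [integral_const_mul, hμ, setIntegral_torusChar]
    simp only [sub_eq_zero]
    split_ifs
    · rw [hc]
      have : (Real.pi : ℂ) ≠ 0 := Complex.ofReal_ne_zero.2 hpi.ne'
      push_cast
      field_simp
    · simp
  have hb := ho.sum_inner_products_le (s := S) hh.toLp
  have hn : ‖hh.toLp‖ ^ 2 = ∫ ξ, h ξ ^ 2 ∂μ := by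
    have h1 := inner_self_eq_norm_sq_to_K (𝕜 := ℂ) hh.toLp
    rw [L2.inner_def] at h1
    have h2 : ∫ ξ, inner ℂ ((hh.toLp : Lp ℂ 2 μ) ξ) ((hh.toLp : Lp ℂ 2 μ) ξ) ∂μ = ((∫ ξ, h ξ ^ 2 ∂μ : ℝ) : ℂ) := by
      rw [← integral_complex_ofReal]
      refine integral_congr_ae ?_
      filter_upwards [hh.coeFn_toLp] with ξ h1
      rw [h1, RCLike.inner_apply, Complex.conj_ofReal]
      push_cast; ring
    rw [h2] at h1
    exact Complex.ofReal_injective ((Complex.ofReal_pow _ _).trans h1.symm)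
  rw [hn] at hb
  simp only [hin _ _ hh, norm_mul, mul_pow, ← Finset.mul_sum, Complex.norm_real,
    Real.norm_of_nonneg hcpos.le] at hb
  have hc2 : c ^ 2 = ((2 * Real.pi) ^ 4)⁻¹ := by rw [hc]; ring
  rwa [hc2, inv_mul_le_iff₀ (by positivity)] at hb

/-- The `x`-th Fourier coefficient of `h` (its real part). -/
noncomputable def torusCoeff (h : (Fin 4 → ℝ) → ℝ) (x : Fin 4 → ℤ) : ℝ :=
  (((2 * Real.pi : ℂ) ^ 4)⁻¹ * ∫ ξ in torusBox 4, torusChar x ξ * (h ξ : ℂ)).re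

theorem sum_torusCoeff_sq_le {h : (Fin 4 → ℝ) → ℝ}
    (hm : MemLp h 2 (volume.restrict (torusBox 4))) (S : Finset (Fin 4 → ℤ)) :
    ∑ x ∈ S, torusCoeff h x ^ 2 ≤ ∫ ξ in torusBox 4, h ξ ^ 2 := by
  have hpi := Real.pi_pos
  have hI : 0 ≤ ∫ ξ in torusBox 4, h ξ ^ 2 := integral_nonneg fun ξ => sq_nonneg _
  have h1 : ∀ x, torusCoeff h x ^ 2 ≤ ((2 * Real.pi) ^ 4)⁻¹ *
      (((2 * Real.pi) ^ 4)⁻¹ * ‖∫ ξ in torusBox 4, torusChar x ξ * (h ξ : ℂ)‖ ^ 2) := fun x => by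
    rw [torusCoeff, inv_two_pi_pow_eq, Complex.re_ofReal_mul, mul_pow, sq (_⁻¹), mul_assoc]
    refine mul_le_mul_of_nonneg_left (mul_le_mul_of_nonneg_left ?_ (by positivity))
      (by positivity)
    rw [← sq_abs]
    gcongr
    exact Complex.abs_re_le_norm _
  calc ∑ x ∈ S, torusCoeff h x ^ 2 ≤ _ := Finset.sum_le_sum fun x _ => h1 x
    _ = ((2 * Real.pi) ^ 4)⁻¹ * (((2 * Real.pi) ^ 4)⁻¹ *
        ∑ x ∈ S, ‖∫ ξ in torusBox 4, torusChar x ξ * (h ξ : ℂ)‖ ^ 2) := by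
      rw [Finset.mul_sum, Finset.mul_sum]
    _ ≤ 1 * (((2 * Real.pi) ^ 4)⁻¹ * ((2 * Real.pi) ^ 4 * ∫ ξ in torusBox 4, h ξ ^ 2)) := by
      gcongr
      · exact inv_two_pi_pow_le_one
      · exact sum_norm_setIntegral_torusChar_sq_le hm S
    _ = _ := by rw [one_mul, inv_mul_cancel_left₀ (by positivity)]

theorem memLp_sin_div_discOmega (t : ℝ) :
    MemLp (fun ξ => Real.sin (t * discOmega 4 ξ) / discOmega 4 ξ) 2
      (volume.restrict (torusBox 4)) := by
  have hω := (continuous_discOmega 4).measurable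
  have hmeas : Measurable fun ξ => Real.sin (t * discOmega 4 ξ) / discOmega 4 ξ := by fun_prop
  rw [memLp_two_iff_integrable_sq hmeas.aestronglyMeasurable]
  refine integrableOn_inv_discOmega_sq.mono' (hmeas.pow_const 2).aestronglyMeasurable
    (Filter.Eventually.of_forall fun ξ => ?_)
  rw [Real.norm_of_nonneg (sq_nonneg _), div_pow, ← one_div]
  gcongr
  exact Real.sin_sq_le_one _

theorem sum_greenG_sq_le (t : ℝ) (S : Finset (Fin 4 → ℤ)) :
    ∑ x ∈ S, greenG 4 x t ^ 2 ≤ ∫ ξ in torusBox 4, (discOmega 4 ξ ^ 2)⁻¹ := by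
  refine (sum_torusCoeff_sq_le (memLp_sin_div_discOmega t) S).trans ?_
  refine integral_mono (memLp_sin_div_discOmega t).integrable_sq integrableOn_inv_discOmega_sq
    fun ξ => ?_
  simp only [div_pow]
  rw [← one_div]
  gcongr
  exact Real.sin_sq_le_one _

theorem greenG_sub (x : Fin 4 → ℤ) (t s : ℝ) :
    greenG 4 x t - greenG 4 x s = torusCoeff (fun ξ =>
      Real.sin (t * discOmega 4 ξ) / discOmega 4 ξ - Real.sin (s * discOmega 4 ξ) / discOmega 4 ξ)
      x := by
  rw [greenG, greenG, torusCoeff, ← Complex.sub_re, ← mul_sub, ← integral_sub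
    (integrableOn_exp_mul_sin_div_discOmega x t) (integrableOn_exp_mul_sin_div_discOmega x s)]
  simp only [torusChar, ← mul_sub, Complex.ofReal_sub]

theorem abs_sin_sub_sin_le (a b : ℝ) : |Real.sin a - Real.sin b| ≤ |a - b| := by
  simpa [Real.dist_eq] using Real.lipschitzWith_sin.dist_le_mul a b

theorem sum_greenG_sub_sq_le (t s : ℝ) (S : Finset (Fin 4 → ℤ)) :
    ∑ x ∈ S, (greenG 4 x t - greenG 4 x s) ^ 2 ≤ (2 * Real.pi) ^ 4 * (t - s) ^ 2 := by
  simp only [greenG_sub]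
  refine (sum_torusCoeff_sq_le ((memLp_sin_div_discOmega t).sub (memLp_sin_div_discOmega s))
    S).trans ?_
  have h1 : ∫ _ξ in torusBox 4, (t - s) ^ 2 = (2 * Real.pi) ^ 4 * (t - s) ^ 2 := by
    rw [setIntegral_const, smul_eq_mul, torusBox_eq_Icc, measureReal_def, Real.volume_Icc_pi_toReal]
    · simp only [Finset.prod_const, Finset.card_univ, Fintype.card_fin]
      ring
    · intro j; have := Real.pi_pos; simp only; linarith
  rw [← h1]
  refine integral_mono ((memLp_sin_div_discOmega t).sub (memLp_sin_div_discOmega s)).integrable_sq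
    (integrableOn_const (volume_torusBox_lt_top 4).ne) fun ξ => ?_
  simp only [Pi.sub_apply]
  rw [← sub_div]
  rcases eq_or_ne (discOmega 4 ξ) 0 with h | h
  · rw [h]; simp [sq_nonneg]
  · rw [div_pow, div_le_iff₀ (by positivity), ← mul_pow, sub_mul]
    exact sq_le_sq.2 (abs_sin_sub_sin_le _ _)

section Convolution

variable {Γ : Type*}

theorem summable_sq_of_lp_two (g : lp (fun _ : Γ => ℝ) 2) : Summable fun x => g x ^ 2 := by
  simpa using (lp.memℓp g).summable (by norm_num)

theorem memℓp_two_of_summable_sq {g : Γ → ℝ} (h : Summable fun x => g x ^ 2) :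
    Memℓp (E := fun _ : Γ => ℝ) g 2 := by
  refine memℓp_gen ?_
  simpa using h

theorem lp_two_norm_sq (g : lp (fun _ : Γ => ℝ) 2) : ‖g‖ ^ 2 = ∑' x, g x ^ 2 := by
  simpa using lp.norm_rpow_eq_tsum (p := 2) (by norm_num) g

theorem summable_abs_of_lp_one (h : lp (fun _ : Γ => ℝ) 1) : Summable fun x => |h x| := by
  simpa using (lp.memℓp h).summable (by norm_num)

theorem lp_one_norm (h : lp (fun _ : Γ => ℝ) 1) : ‖h‖ = ∑' x, |h x| := by
  simpa using lp.norm_rpow_eq_tsum (p := 1) (by norm_num) h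

variable [AddCommGroup Γ]

/-- Translation on `ℓ²`. -/
noncomputable def lpTranslate (y : Γ) (g : lp (fun _ : Γ => ℝ) 2) : lp (fun _ : Γ => ℝ) 2 :=
  ⟨fun x => g (x - y), memℓp_two_of_summable_sq
    ((Equiv.subRight y).summable_iff.2 (summable_sq_of_lp_two g))⟩

@[simp]
theorem lpTranslate_apply (y : Γ) (g : lp (fun _ : Γ => ℝ) 2) (x : Γ) :
    lpTranslate y g x = g (x - y) := rfl

theorem norm_lpTranslate (y : Γ) (g : lp (fun _ : Γ => ℝ) 2) : ‖lpTranslate y g‖ = ‖g‖ := by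
  rw [← sq_eq_sq₀ (norm_nonneg _) (norm_nonneg _), lp_two_norm_sq, lp_two_norm_sq]
  exact (Equiv.subRight y).tsum_eq fun x => g x ^ 2

theorem summable_norm_smul_lpTranslate (g : lp (fun _ : Γ => ℝ) 2) (h : lp (fun _ : Γ => ℝ) 1) :
    Summable fun y => ‖h y • lpTranslate y g‖ := by
  simp only [norm_smul, norm_lpTranslate, Real.norm_eq_abs]
  exact (summable_abs_of_lp_one h).mul_right _

theorem summable_smul_lpTranslate (g : lp (fun _ : Γ => ℝ) 2) (h : lp (fun _ : Γ => ℝ) 1) :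
    Summable fun y => h y • lpTranslate y g :=
  (summable_norm_smul_lpTranslate g h).of_norm

/-- Convolution `ℓ² × ℓ¹ → ℓ²`. -/
noncomputable def lpConv (Γ : Type*) [AddCommGroup Γ] :
    lp (fun _ : Γ => ℝ) 2 →L[ℝ] lp (fun _ : Γ => ℝ) 1 →L[ℝ] lp (fun _ : Γ => ℝ) 2 :=
  LinearMap.mkContinuous₂
    (LinearMap.mk₂ ℝ (fun g h => ∑' y, h y • lpTranslate y g)
      (fun g g' h => by
        rw [← (summable_smul_lpTranslate g h).tsum_add (summable_smul_lpTranslate g' h)]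
        congr 1 with y x
        exact mul_add (h y) (g (x - y)) (g' (x - y)))
      (fun c g h => by
        rw [← (summable_smul_lpTranslate g h).tsum_const_smul c]
        congr 1 with y x
        simp
        ring)
      (fun g h h' => by
        rw [← (summable_smul_lpTranslate g h).tsum_add (summable_smul_lpTranslate g h')]
        congr 1 with y x
        exact add_mul (h y) (h' y) (g (x - y)))
      (fun c g h => by
        rw [← (summable_smul_lpTranslate g h).tsum_const_smul c]
        congr 1 with y x
        simp
        ring))
    1 (fun g h => by
      simp only [LinearMap.mk₂_apply, one_mul]
      refine (norm_tsum_le_tsum_norm (summable_norm_smul_lpTranslate g h)).trans_eq ?_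
      simp only [norm_smul, norm_lpTranslate, Real.norm_eq_abs]
      rw [tsum_mul_right, lp_one_norm, mul_comm])

theorem lpConv_apply_apply (g : lp (fun _ : Γ => ℝ) 2) (h : lp (fun _ : Γ => ℝ) 1) (x : Γ) :
    lpConv Γ g h x = ∑' y, g (x - y) * h y := by
  have h1 : lpConv Γ g h = ∑' y, h y • lpTranslate y g := rfl
  rw [h1]
  have := (lp.evalCLM ℝ (fun _ : Γ => ℝ) 2 x).map_tsum (summable_smul_lpTranslate g h)
  exact this.trans (tsum_congr fun y => mul_comm (h y) (g (x - y)))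

theorem norm_lpConv_le (g : lp (fun _ : Γ => ℝ) 2) (h : lp (fun _ : Γ => ℝ) 1) :
    ‖lpConv Γ g h‖ ≤ ‖g‖ * ‖h‖ := by
  have := (lpConv Γ).le_of_opNorm₂_le_of_le (LinearMap.mkContinuous₂_norm_le _ zero_le_one _)
    (le_refl ‖g‖) (le_refl ‖h‖)
  simpa using this

theorem abs_lpConv_apply_le {g : lp (fun _ : Γ => ℝ) 2} {A : ℝ} (hA : ∀ x, |g x| ≤ A)
    (h : lp (fun _ : Γ => ℝ) 1) (x : Γ) : |lpConv Γ g h x| ≤ A * ‖h‖ := by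
  rw [lpConv_apply_apply, lp_one_norm, ← tsum_mul_left]
  have hs : Summable fun y => A * |h y| := (summable_abs_of_lp_one h).mul_left A
  rw [← Real.norm_eq_abs]
  refine tsum_of_norm_bounded hs.hasSum fun y => ?_
  rw [norm_mul, Real.norm_eq_abs, Real.norm_eq_abs]
  gcongr
  exact hA _

end Convolution

theorem abs_abs_pow_mul_sub_le (m : ℕ) {a b R : ℝ} (ha : |a| ≤ R) (hb : |b| ≤ R) :
    |(|a| ^ (m + 1) * a - |b| ^ (m + 1) * b)| ≤
      (m + 2) * R ^ m * (|a| * |a - b| + |b| * |a - b|) := by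
  have hR : 0 ≤ R := (abs_nonneg a).trans ha
  have hM : max |a| |b| ≤ R := max_le ha hb
  have h1 : |(|a| ^ (m + 1) - |b| ^ (m + 1))| ≤ (m + 1) * R ^ m * |a - b| := by
    have h2 := abs_pow_sub_pow_le (|a|) (|b|) (m + 1)
    simp only [abs_abs, Nat.add_sub_cancel, Nat.cast_add, Nat.cast_one] at h2
    calc _ ≤ _ := h2
      _ ≤ |a - b| * (m + 1) * R ^ m := by
        refine mul_le_mul (mul_le_mul_of_nonneg_right (abs_abs_sub_abs_le a b) (by positivity))
          (pow_le_pow_left₀ (by positivity) hM m) (by positivity) (by positivity)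
      _ = _ := by ring
  have h3 : |a| ^ (m + 1) * a - |b| ^ (m + 1) * b =
      |a| ^ (m + 1) * (a - b) + (|a| ^ (m + 1) - |b| ^ (m + 1)) * b := by ring
  rw [h3]
  calc _ ≤ |a| ^ m * |a| * |a - b| + (m + 1) * R ^ m * |a - b| * |b| := by
        refine (abs_add_le _ _).trans (add_le_add (le_of_eq ?_) ?_)
        · rw [abs_mul, abs_pow, abs_abs, pow_succ]
        · rw [abs_mul]
          gcongr
    _ ≤ R ^ m * |a| * |a - b| + (m + 1) * R ^ m * |a - b| * |b| := by gcongr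
    _ ≤ _ := by
      have e1 : 0 ≤ R ^ m * |a| * |a - b| := by positivity
      have e2 : 0 ≤ R ^ m * |b| * |a - b| := by positivity
      nlinarith [mul_nonneg (Nat.cast_nonneg (α := ℝ) m) e1]

section PowerNonlinearity

variable {Γ : Type*}

theorem summable_abs_mul_abs_and_tsum_le (u v : lp (fun _ : Γ => ℝ) 2) :
    (Summable fun x => |u x| * |v x|) ∧ ∑' x, |u x| * |v x| ≤ ‖u‖ * ‖v‖ := by
  have h : ∀ w : lp (fun _ : Γ => ℝ) 2, Memℓp (E := fun _ : Γ => ℝ) (fun x => |w x|) 2 := fun w =>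
    memℓp_two_of_summable_sq (by simpa using summable_sq_of_lp_two w)
  have hn : ∀ w : lp (fun _ : Γ => ℝ) 2,
      ‖(⟨fun x => |w x|, h w⟩ : lp (fun _ : Γ => ℝ) 2)‖ = ‖w‖ := fun w => by
    rw [← sq_eq_sq₀ (norm_nonneg _) (norm_nonneg _), lp_two_norm_sq, lp_two_norm_sq]
    simp
  have h1 := lp.summable_inner (𝕜 := ℝ) (⟨fun x => |v x|, h v⟩ : lp (fun _ : Γ => ℝ) 2)
    ⟨fun x => |u x|, h u⟩
  have h2 := real_inner_le_norm (⟨fun x => |v x|, h v⟩ : lp (fun _ : Γ => ℝ) 2)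
    ⟨fun x => |u x|, h u⟩
  rw [lp.inner_eq_tsum, hn, hn, mul_comm] at h2
  exact ⟨h1, h2⟩

theorem abs_apply_le_lp_two_norm (u : lp (fun _ : Γ => ℝ) 2) (x : Γ) : |u x| ≤ ‖u‖ :=
  lp.norm_apply_le_norm (by norm_num) u x

theorem memℓp_one_abs_pow_mul (m : ℕ) (u : lp (fun _ : Γ => ℝ) 2) :
    Memℓp (E := fun _ : Γ => ℝ) (fun x => |u x| ^ (m + 1) * u x) 1 := by
  refine memℓp_gen ?_
  simp only [ENNReal.toReal_one, Real.rpow_one]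
  refine ((summable_sq_of_lp_two u).mul_left (‖u‖ ^ m)).of_nonneg_of_le
    (fun _ => norm_nonneg _) fun x => ?_
  rw [Real.norm_eq_abs, abs_mul, abs_pow, abs_abs, pow_succ, mul_assoc, ← sq_abs, sq]
  gcongr
  exact abs_apply_le_lp_two_norm u x

/-- The nonlinearity `u ↦ |u|^{m+1} u` from `ℓ²` to `ℓ¹`. -/
noncomputable def lpPower (m : ℕ) (u : lp (fun _ : Γ => ℝ) 2) : lp (fun _ : Γ => ℝ) 1 :=
  ⟨fun x => |u x| ^ (m + 1) * u x, memℓp_one_abs_pow_mul m u⟩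

@[simp]
theorem lpPower_apply (m : ℕ) (u : lp (fun _ : Γ => ℝ) 2) (x : Γ) :
    lpPower m u x = |u x| ^ (m + 1) * u x := rfl

theorem norm_lpPower_sub_le (m : ℕ) {u v : lp (fun _ : Γ => ℝ) 2} {R : ℝ}
    (hu : ∀ x, |u x| ≤ R) (hv : ∀ x, |v x| ≤ R) :
    ‖lpPower m u - lpPower m v‖ ≤ (m + 2) * R ^ m * ((‖u‖ + ‖v‖) * ‖u - v‖) := by
  rcases isEmpty_or_nonempty Γ with hΓ | ⟨⟨x₀⟩⟩
  · have h1 : u - v = 0 := Subsingleton.elim _ _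
    have h2 : lpPower m u - lpPower m v = 0 := Subsingleton.elim _ _
    simp [h1, h2]
  have hR : 0 ≤ R := (abs_nonneg _).trans (hu x₀)
  obtain ⟨s1, t1⟩ := summable_abs_mul_abs_and_tsum_le u (u - v)
  obtain ⟨s2, t2⟩ := summable_abs_mul_abs_and_tsum_le v (u - v)
  rw [lp_one_norm]
  calc ∑' x, |(lpPower m u - lpPower m v) x|
      ≤ ∑' x, (m + 2) * R ^ m * (|u x| * |(u - v) x| + |v x| * |(u - v) x|) :=
        (summable_abs_of_lp_one _).tsum_le_tsum
          (fun x => abs_abs_pow_mul_sub_le m (hu x) (hv x)) ((s1.add s2).mul_left _)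
    _ ≤ _ := by
        rw [tsum_mul_left, s1.tsum_add s2, add_mul ‖u‖]
        exact mul_le_mul_of_nonneg_left (add_le_add t1 t2) (by positivity)

theorem norm_lpPower_le (m : ℕ) {u : lp (fun _ : Γ => ℝ) 2} {R : ℝ} (hu : ∀ x, |u x| ≤ R) :
    ‖lpPower m u‖ ≤ R ^ m * ‖u‖ ^ 2 := by
  rw [lp_one_norm, lp_two_norm_sq, ← tsum_mul_left]
  refine (summable_abs_of_lp_one _).tsum_le_tsum (fun x => ?_)
    ((summable_sq_of_lp_two u).mul_left _)
  rw [lpPower_apply, abs_mul, abs_pow, abs_abs, pow_succ, mul_assoc, ← sq_abs, sq]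
  gcongr
  exact hu x

theorem continuous_lpPower (m : ℕ) :
    Continuous (lpPower m : lp (fun _ : Γ => ℝ) 2 → lp (fun _ : Γ => ℝ) 1) := by
  rw [continuous_iff_continuousAt]
  intro u
  rw [ContinuousAt, tendsto_iff_norm_sub_tendsto_zero]
  have h1 : Continuous fun v : lp (fun _ : Γ => ℝ) 2 =>
      (m + 2) * (max ‖v‖ ‖u‖) ^ m * ((‖v‖ + ‖u‖) * ‖v - u‖) := by fun_prop
  refine squeeze_zero (fun _ => norm_nonneg _) (fun v => norm_lpPower_sub_le m
    (fun x => (abs_apply_le_lp_two_norm v x).trans (le_max_left _ _))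
    (fun x => (abs_apply_le_lp_two_norm u x).trans (le_max_right _ _))) ?_
  have := h1.tendsto u
  simpa using this

end PowerNonlinearity

/-- The decay weight `(1 + |t|)^{-γ}`. -/
noncomputable def decayWeight (γ t : ℝ) : ℝ := (1 + |t|) ^ (-γ)

theorem decayWeight_pos (γ t : ℝ) : 0 < decayWeight γ t :=
  Real.rpow_pos_of_pos (by positivity) _

theorem decayWeight_le_one {γ : ℝ} (hγ : 0 ≤ γ) (t : ℝ) : decayWeight γ t ≤ 1 :=
  Real.rpow_le_one_of_one_le_of_nonpos (by linarith [abs_nonneg t]) (by linarith)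

theorem continuous_decayWeight (γ : ℝ) : Continuous (decayWeight γ) := by
  unfold decayWeight
  exact Continuous.rpow_const (by fun_prop) fun t => Or.inl (by positivity)

theorem integrable_decayWeight {γ : ℝ} (hγ : 1 < γ) : Integrable (decayWeight γ) := by
  change Integrable fun t : ℝ => (1 + |t|) ^ (-γ)
  simpa using integrable_one_add_norm (E := ℝ) (μ := volume) (r := γ) (by simpa using hγ)

theorem decayWeight_sub_mul_le {γ : ℝ} (hγ : 0 ≤ γ) (t s : ℝ) :
    decayWeight γ (t - s) * decayWeight γ s ≤
      2 ^ γ * decayWeight γ t * (decayWeight γ (t - s) + decayWeight γ s) := by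
  have key : ∀ a : ℝ, |t| ≤ 2 * |a| → decayWeight γ a ≤ 2 ^ γ * decayWeight γ t := fun a ha => by
    have h1 : (2 : ℝ) ^ γ = (1 / 2) ^ (-γ) := by
      rw [Real.rpow_neg (by norm_num), ← Real.inv_rpow (by norm_num)]; norm_num
    rw [decayWeight, decayWeight, h1, ← Real.mul_rpow (by norm_num) (by positivity)]
    exact Real.rpow_le_rpow_of_nonpos (by positivity) (by linarith) (by linarith)
  have p1 := decayWeight_pos γ (t - s)
  have p2 := decayWeight_pos γ s
  have p3 := decayWeight_pos γ t
  have p4 : 0 < (2 : ℝ) ^ γ := by positivity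
  rw [mul_add]
  rcases le_total |t - s| |s| with h | h
  · have h2 := key s (by have := abs_add_le (t - s) s; rw [sub_add_cancel] at this; linarith)
    nlinarith [mul_le_mul_of_nonneg_left h2 p1.le, mul_pos (mul_pos p4 p3) p2]
  · have h2 := key (t - s) (by have := abs_add_le (t - s) s; rw [sub_add_cancel] at this; linarith)
    nlinarith [mul_le_mul_of_nonneg_right h2 p2.le, mul_pos (mul_pos p4 p3) p1]

theorem integrable_decayWeight_sub_mul {γ : ℝ} (hγ : 1 < γ) (t : ℝ) :
    Integrable fun s => decayWeight γ (t - s) * decayWeight γ s := by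
  refine (integrable_decayWeight hγ).mono' (Continuous.aestronglyMeasurable
    (((continuous_decayWeight γ).comp (by fun_prop)).mul (continuous_decayWeight γ)))
    (Filter.Eventually.of_forall fun s => ?_)
  rw [Real.norm_of_nonneg (mul_nonneg (decayWeight_pos _ _).le (decayWeight_pos _ _).le)]
  exact mul_le_of_le_one_left (decayWeight_pos _ _).le (decayWeight_le_one (by linarith) _)

theorem exists_integral_decayWeight_le {γ : ℝ} (hγ : 1 < γ) :
    ∃ W : ℝ, 0 < W ∧ ∫ s, decayWeight γ s ≤ W ∧
      ∀ t, ∫ s, decayWeight γ (t - s) * decayWeight γ s ≤ W * decayWeight γ t := by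
  have hI := integrable_decayWeight hγ
  set I := ∫ s, decayWeight γ s with hIdef
  have hI0 : 0 ≤ I := integral_nonneg fun s => (decayWeight_pos _ _).le
  have h2 : (0 : ℝ) < 2 ^ γ := by positivity
  refine ⟨2 ^ γ * (I + I) + I + 1, by positivity, ?_, fun t => ?_⟩
  · have : 0 ≤ (2 : ℝ) ^ γ * (I + I) := by positivity
    linarith
  have hw := decayWeight_pos γ t
  have hIt : Integrable fun s => decayWeight γ (t - s) := hI.comp_sub_left t
  calc ∫ s, decayWeight γ (t - s) * decayWeight γ s
      ≤ ∫ s, 2 ^ γ * decayWeight γ t * (decayWeight γ (t - s) + decayWeight γ s) :=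
        integral_mono (integrable_decayWeight_sub_mul hγ t) ((hIt.add hI).const_mul _)
          fun s => decayWeight_sub_mul_le (by linarith) t s
    _ = 2 ^ γ * decayWeight γ t * (I + I) := by
        rw [integral_const_mul, integral_add hIt hI, integral_sub_left_eq_self]
    _ ≤ _ := by nlinarith [mul_nonneg hI0 hw.le]

theorem norm_intervalIntegral_le_integral {E : Type*} [NormedAddCommGroup E] [NormedSpace ℝ E]
    {φ : ℝ → E} {ψ : ℝ → ℝ} (hψ : Integrable ψ) (h : ∀ s, ‖φ s‖ ≤ ψ s) (a b : ℝ) :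
    ‖∫ s in a..b, φ s‖ ≤ ∫ s, ψ s := by
  rw [intervalIntegral.norm_integral_eq_norm_integral_uIoc]
  exact (norm_integral_le_of_norm_le hψ.integrableOn (Filter.Eventually.of_forall h)).trans
    (setIntegral_le_integral hψ (Filter.Eventually.of_forall fun s => (norm_nonneg _).trans (h s)))

section Duhamel

variable {Γ : Type*} [AddCommGroup Γ]

/-- The Duhamel integral of the source term `h` for the propagator `g`. -/
noncomputable def lpDuhamel (g : ℝ → lp (fun _ : Γ => ℝ) 2) (h : ℝ → lp (fun _ : Γ => ℝ) 1)
    (t : ℝ) : lp (fun _ : Γ => ℝ) 2 :=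
  ∫ s in (0 : ℝ)..t, lpConv Γ (g (t - s)) (h s)

variable {g : ℝ → lp (fun _ : Γ => ℝ) 2} {h h' : ℝ → lp (fun _ : Γ => ℝ) 1}

theorem continuous_lpConv_sub (hg : Continuous g) (hh : Continuous h) :
    Continuous fun p : ℝ × ℝ => lpConv Γ (g (p.1 - p.2)) (h p.2) :=
  ((lpConv Γ).continuous.comp (hg.comp (by fun_prop))).clm_apply (hh.comp continuous_snd)

theorem intervalIntegrable_lpConv (hg : Continuous g) (hh : Continuous h) (t : ℝ) :
    IntervalIntegrable (fun s => lpConv Γ (g (t - s)) (h s)) volume 0 t :=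
  ((continuous_lpConv_sub hg hh).comp (by fun_prop : Continuous fun s : ℝ => (t, s))
    ).intervalIntegrable _ _

theorem continuous_lpDuhamel (hg : Continuous g) (hh : Continuous h) :
    Continuous (lpDuhamel g h) :=
  intervalIntegral.continuous_parametric_intervalIntegral_of_continuous
    (f := fun t s => lpConv Γ (g (t - s)) (h s)) (continuous_lpConv_sub hg hh) continuous_id

theorem lpDuhamel_sub (hg : Continuous g) (hh : Continuous h) (hh' : Continuous h') (t : ℝ) :
    lpDuhamel g h t - lpDuhamel g h' t = lpDuhamel g (fun s => h s - h' s) t := by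
  simp only [lpDuhamel, map_sub]
  rw [intervalIntegral.integral_sub (intervalIntegrable_lpConv hg hh t)
    (intervalIntegrable_lpConv hg hh' t)]

theorem lpDuhamel_apply (hg : Continuous g) (hh : Continuous h) (t : ℝ) (x : Γ) :
    lpDuhamel g h t x = ∫ s in (0 : ℝ)..t, lpConv Γ (g (t - s)) (h s) x :=
  ((lp.evalCLM ℝ (fun _ : Γ => ℝ) 2 x).intervalIntegral_comp_comm
    (intervalIntegrable_lpConv hg hh t)).symm

theorem norm_lpDuhamel_le {γ C A W : ℝ} (hγ : 1 < γ) (hA : 0 ≤ A) (hgC : ∀ t, ‖g t‖ ≤ C)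
    (hhA : ∀ s, ‖h s‖ ≤ A * decayWeight γ s) (hW : ∫ s, decayWeight γ s ≤ W) (t : ℝ) :
    ‖lpDuhamel g h t‖ ≤ C * A * W := by
  have hC : 0 ≤ C := (norm_nonneg _).trans (hgC 0)
  refine (norm_intervalIntegral_le_integral (ψ := fun s => C * A * decayWeight γ s)
    ((integrable_decayWeight hγ).const_mul _) (fun s => ?_) 0 t).trans ?_
  · refine (norm_lpConv_le _ _).trans ?_
    rw [mul_assoc]
    exact mul_le_mul (hgC _) (hhA s) (norm_nonneg _) hC
  · rw [integral_const_mul]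
    gcongr

theorem abs_lpDuhamel_apply_le {γ C A W : ℝ} (hγ : 1 < γ) (hA : 0 ≤ A) (hC : 0 ≤ C)
    (hg : Continuous g) (hh : Continuous h) (hgC : ∀ t x, |g t x| ≤ C * decayWeight γ t)
    (hhA : ∀ s, ‖h s‖ ≤ A * decayWeight γ s)
    (hW : ∀ t, ∫ s, decayWeight γ (t - s) * decayWeight γ s ≤ W * decayWeight γ t)
    (t : ℝ) (x : Γ) : |lpDuhamel g h t x| ≤ C * A * W * decayWeight γ t := by
  rw [lpDuhamel_apply hg hh, ← Real.norm_eq_abs]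
  refine (norm_intervalIntegral_le_integral
    (ψ := fun s => C * A * (decayWeight γ (t - s) * decayWeight γ s))
    ((integrable_decayWeight_sub_mul hγ t).const_mul _) (fun s => ?_) 0 t).trans ?_
  · have hw := decayWeight_pos γ (t - s)
    refine (abs_lpConv_apply_le (hgC (t - s)) (h s) x).trans ?_
    calc _ ≤ C * decayWeight γ (t - s) * (A * decayWeight γ s) := by gcongr; exact hhA s
      _ = _ := by ring
  · rw [integral_const_mul, mul_assoc _ W]
    gcongr
    exact hW t

end Duhamel

section FixedPoint

open scoped BoundedContinuousFunction

variable {Γ : Type*}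

/-- Curves in `ℓ²` bounded by `M` and decaying pointwise like `M (1 + |t|)^{-γ}`. -/
def decayBall (Γ : Type*) (γ M : ℝ) : Set (ℝ →ᵇ lp (fun _ : Γ => ℝ) 2) :=
  {u | ∀ t, ‖u t‖ ≤ M ∧ ∀ x, |u t x| ≤ M * decayWeight γ t}

theorem isClosed_decayBall (γ M : ℝ) : IsClosed (decayBall Γ γ M) := by
  have hev : ∀ t : ℝ, Continuous fun u : ℝ →ᵇ lp (fun _ : Γ => ℝ) 2 => u t := fun t =>
    continuous_eval_const t
  simp only [decayBall, Set.ofPred_forall, Set.ofPred_and]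
  refine isClosed_iInter fun t => ((isClosed_le (hev t).norm continuous_const).inter
    (isClosed_iInter fun x => ?_))
  exact isClosed_le (((lp.evalCLM ℝ (fun _ : Γ => ℝ) 2 x).continuous.comp (hev t)).abs)
    continuous_const

theorem norm_lpPower_le_of_mem_decayBall {γ M : ℝ} (hγ : 0 ≤ γ) (hM : 0 ≤ M) {m : ℕ} (hm : 1 ≤ m)
    {u : ℝ →ᵇ lp (fun _ : Γ => ℝ) 2} (hu : u ∈ decayBall Γ γ M) (s : ℝ) :
    ‖lpPower m (u s)‖ ≤ M ^ (m + 2) * decayWeight γ s := by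
  have hw := decayWeight_pos γ s
  refine (norm_lpPower_le m (hu s).2).trans ?_
  calc _ ≤ (M * decayWeight γ s) ^ m * M ^ 2 := by gcongr; exact (hu s).1
    _ = M ^ (m + 2) * decayWeight γ s ^ m := by ring
    _ ≤ _ := by
      gcongr
      exact pow_le_of_le_one hw.le (decayWeight_le_one hγ s) (by omega)

theorem norm_lpPower_sub_le_of_mem_decayBall {γ M : ℝ} (hγ : 0 ≤ γ) (hM : 0 ≤ M) {m : ℕ}
    (hm : 1 ≤ m) {u v : ℝ →ᵇ lp (fun _ : Γ => ℝ) 2} (hu : u ∈ decayBall Γ γ M)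
    (hv : v ∈ decayBall Γ γ M) (s : ℝ) :
    ‖lpPower m (u s) - lpPower m (v s)‖ ≤
      (m + 2) * M ^ m * (2 * M * dist u v) * decayWeight γ s := by
  have hw := decayWeight_pos γ s
  refine (norm_lpPower_sub_le m (hu s).2 (hv s).2).trans ?_
  calc _ ≤ (m + 2) * (M * decayWeight γ s) ^ m * ((M + M) * dist u v) := by
        gcongr
        · exact (hu s).1
        · exact (hv s).1
        · rw [← dist_eq_norm]; exact BoundedContinuousFunction.dist_coe_le_dist s
    _ = (m + 2) * M ^ m * (2 * M * dist u v) * decayWeight γ s ^ m := by ring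
    _ ≤ _ := by
      gcongr
      exact pow_le_of_le_one hw.le (decayWeight_le_one hγ s) (by omega)

variable [AddCommGroup Γ]

/-- Small data global existence for the abstract Duhamel equation. -/
theorem exists_solution_lpDuhamel {γ C : ℝ} (hγ : 1 < γ) (hC : 0 < C)
    {g : ℝ → lp (fun _ : Γ => ℝ) 2} (hg : Continuous g) (hgC : ∀ t, ‖g t‖ ≤ C)
    (hgw : ∀ t x, |g t x| ≤ C * decayWeight γ t) {m : ℕ} (hm : 1 ≤ m) :
    ∃ δ M : ℝ, 0 < δ ∧ 0 < M ∧ ∀ f : lp (fun _ : Γ => ℝ) 1, ‖f‖ ≤ δ →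
      ∃ u ∈ decayBall Γ γ M, ∀ t,
        u t = lpConv Γ (g t) f + lpDuhamel g (fun s => lpPower m (u s)) t := by
  obtain ⟨W, hW0, hW1, hW2⟩ := exists_integral_decayWeight_le hγ
  have hγ0 : 0 ≤ γ := by linarith
  set K : ℝ := 4 * (m + 2) * C * W with hK
  have hK0 : 0 < K := by positivity
  set M : ℝ := 1 / (1 + K) with hMdef
  have hM0 : 0 < M := by positivity
  have hM1 : M ≤ 1 := by rw [hMdef, div_le_one (by positivity)]; linarith
  have hMK : K * M ≤ 1 := by
    rw [hMdef, mul_one_div, div_le_one (by positivity)]; linarith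
  have hCWM : C * W * M ≤ 1 / 8 := by
    have : 0 ≤ (m : ℝ) * (C * W * M) := by positivity
    rw [hK] at hMK
    nlinarith
  refine ⟨M / (2 * C), M, by positivity, hM0, fun f hf => ?_⟩
  have hCf : C * ‖f‖ ≤ M / 2 := by
    calc C * ‖f‖ ≤ C * (M / (2 * C)) := by gcongr
      _ = M / 2 := by field_simp
  have hpow : C * M ^ (m + 2) * W ≤ M / 2 := by
    have : M ^ (m + 2) ≤ M ^ 2 := pow_le_pow_of_le_one hM0.le hM1 (by omega)
    calc C * M ^ (m + 2) * W ≤ C * M ^ 2 * W := by gcongr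
      _ = (C * W * M) * M := by ring
      _ ≤ 1 / 8 * M := by gcongr
      _ ≤ M / 2 := by linarith
  have hN : ∀ u : ℝ →ᵇ lp (fun _ : Γ => ℝ) 2, Continuous fun s => lpPower m (u s) := fun u =>
    (continuous_lpPower m).comp u.continuous
  have hΦ : ∀ u : decayBall Γ γ M, ∃ v : decayBall Γ γ M, ∀ t, v.1 t =
      lpConv Γ (g t) f + lpDuhamel g (fun s => lpPower m (u.1 s)) t := by
    rintro ⟨u, hu⟩
    have hb := norm_lpPower_le_of_mem_decayBall hγ0 hM0.le hm hu
    have h1 : ∀ t, ‖lpConv Γ (g t) f + lpDuhamel g (fun s => lpPower m (u s)) t‖ ≤ M := by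
      intro t
      refine (norm_add_le _ _).trans ?_
      have e1 : ‖lpConv Γ (g t) f‖ ≤ C * ‖f‖ :=
        (norm_lpConv_le _ _).trans (by gcongr; exact hgC t)
      have e2 := norm_lpDuhamel_le hγ (by positivity) hgC hb hW1 t
      linarith
    have hcont : Continuous fun t =>
        lpConv Γ (g t) f + lpDuhamel g (fun s => lpPower m (u s)) t :=
      (((lpConv Γ).continuous.comp hg).clm_apply continuous_const).add
        (continuous_lpDuhamel hg (hN u))
    refine ⟨⟨BoundedContinuousFunction.ofNormedAddCommGroup _ hcont M h1, fun t => ⟨h1 t, ?_⟩⟩,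
      fun t => rfl⟩
    intro x
    have hw := decayWeight_pos γ t
    have e1 := abs_lpConv_apply_le (hgw t) f x
    have e2 := abs_lpDuhamel_apply_le hγ (by positivity) hC.le hg (hN u) hgw hb hW2 t x
    refine (abs_add_le (lpConv Γ (g t) f x) (lpDuhamel g (fun s => lpPower m (u s)) t x)).trans ?_
    have e3 := mul_le_mul_of_nonneg_right hCf hw.le
    have e4 := mul_le_mul_of_nonneg_right hpow hw.le
    linarith
  choose Φ hΦ using hΦ
  have hlip : LipschitzWith (1 / 2 : NNReal) Φ := by
    refine LipschitzWith.of_dist_le_mul fun u v => ?_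
    have hd : 0 ≤ dist u v := dist_nonneg
    rw [Subtype.dist_eq, BoundedContinuousFunction.dist_le (by positivity)]
    intro t
    rw [dist_eq_norm, hΦ u, hΦ v, add_sub_add_left_eq_sub, lpDuhamel_sub hg (hN u.1) (hN v.1)]
    refine (norm_lpDuhamel_le hγ (by positivity) hgC
      (norm_lpPower_sub_le_of_mem_decayBall hγ0 hM0.le hm u.2 v.2) hW1 t).trans ?_
    have hpm : M ^ m ≤ 1 := pow_le_one₀ hM0.le hM1
    calc C * ((m + 2) * M ^ m * (2 * M * dist u.1 v.1)) * W
        ≤ C * ((m + 2) * 1 * (2 * M * dist u.1 v.1)) * W := by gcongr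
      _ = (K * M) / 2 * dist u v := by rw [hK, Subtype.dist_eq]; ring
      _ ≤ 1 / 2 * dist u v := by gcongr
      _ = _ := by norm_num
  have hcontr : ContractingWith (1 / 2 : NNReal) Φ :=
    ⟨by rw [← NNReal.coe_lt_coe]; norm_num, hlip⟩
  have : CompleteSpace (decayBall Γ γ M) := (isClosed_decayBall γ M).completeSpace_coe
  have : Nonempty (decayBall Γ γ M) := ⟨⟨0, fun t => ⟨by simpa using hM0.le, fun x => by
    simpa using mul_nonneg hM0.le (decayWeight_pos γ t).le⟩⟩⟩
  refine ⟨_, (hcontr.fixedPoint Φ).2, fun t => ?_⟩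
  conv_lhs => rw [← hcontr.fixedPoint_isFixedPt]
  exact hΦ _ t

end FixedPoint

/-- The Green's function as a curve in `ℓ²`. -/
noncomputable def lpGreen (t : ℝ) : lp (fun _ : Fin 4 → ℤ => ℝ) 2 :=
  ⟨fun x => greenG 4 x t, memℓp_two_of_summable_sq
    (summable_of_sum_le (fun _ => sq_nonneg _) (sum_greenG_sq_le t))⟩

theorem norm_lpGreen_le (t : ℝ) :
    ‖lpGreen t‖ ≤ √(∫ ξ in torusBox 4, (discOmega 4 ξ ^ 2)⁻¹) := by
  refine Real.le_sqrt_of_sq_le ?_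
  rw [lp_two_norm_sq]
  exact Real.tsum_le_of_sum_le (fun _ => sq_nonneg _) (sum_greenG_sq_le t)

theorem norm_lpGreen_sub_le (t s : ℝ) :
    ‖lpGreen t - lpGreen s‖ ≤ (2 * Real.pi) ^ 2 * |t - s| := by
  have hpi := Real.pi_pos
  refine le_of_sq_le_sq ?_ (by positivity)
  rw [lp_two_norm_sq, mul_pow, sq_abs, ← pow_mul]
  exact Real.tsum_le_of_sum_le (fun _ => sq_nonneg _) (sum_greenG_sub_sq_le t s)

theorem continuous_lpGreen : Continuous lpGreen := by
  refine (LipschitzWith.of_dist_le_mul (K := ⟨(2 * Real.pi) ^ 2, by positivity⟩)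
    fun t s => ?_).continuous
  rw [dist_eq_norm, Real.dist_eq]
  exact norm_lpGreen_sub_le t s

theorem exists_lp_one_of_lpNorm_le {f : (Fin 4 → ℤ) → ℝ} {δ : ℝ} (hδ : 0 ≤ δ)
    (hf : lpNorm 4 1 f ≤ ENNReal.ofReal δ) :
    ∃ f' : lp (fun _ : Fin 4 → ℤ => ℝ) 1, (∀ x, f' x = f x) ∧ ‖f'‖ ≤ δ := by
  rw [_root_.lpNorm, eLpNorm_one_eq_lintegral_enorm, lintegral_count] at hf
  have hs : Summable fun x => ‖f x‖ :=
    (Summable.of_enorm (hf.trans_lt ENNReal.ofReal_lt_top).ne).norm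
  refine ⟨⟨f, memℓp_gen (by simpa using hs)⟩, fun x => rfl, ?_⟩
  rw [lp_one_norm, ← ENNReal.ofReal_le_ofReal_iff hδ,
    ENNReal.ofReal_tsum_of_nonneg (fun _ => abs_nonneg _) hs]
  simpa [← Real.norm_eq_abs, ofReal_norm] using hf

/-- Interpolation between `ℓ²` and `ℓ^∞`. -/
theorem lpNorm_le_of_norm_le (u : lp (fun _ : Fin 4 → ℤ => ℝ) 2) {M w : ℝ} (hM : 0 < M)
    (hw : 0 < w) (h2 : ‖u‖ ≤ M) (hinf : ∀ x, |u x| ≤ M * w) {p : ℝ≥0∞} (hp : 2 ≤ p) :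
    lpNorm 4 p (fun x => u x) ≤ ENNReal.ofReal (M * w ^ (1 - 2 / p.toReal)) := by
  rcases eq_or_ne p ∞ with rfl | hpt
  · rw [ENNReal.toReal_top, _root_.div_zero, _root_.sub_zero, Real.rpow_one]
    rw [_root_.lpNorm, eLpNorm_exponent_top]
    refine eLpNormEssSup_le_of_ae_bound (Filter.Eventually.of_forall fun x => ?_)
    exact hinf x
  have hp0 : p ≠ 0 := (lt_of_lt_of_le (by norm_num) hp).ne'
  set q := p.toReal with hq
  have hq2 : 2 ≤ q := by
    have := ENNReal.toReal_mono hpt hp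
    simpa using this
  have hq0 : 0 < q := by linarith
  rw [_root_.lpNorm, eLpNorm_eq_lintegral_rpow_enorm_toReal hp0 hpt, lintegral_count, ← hq]
  have hterm : ∀ x, |u x| ^ q ≤ (M * w) ^ (q - 2) * u x ^ 2 := fun x => by
    rcases eq_or_ne (u x) 0 with h0 | h0
    · rw [h0, abs_zero, Real.zero_rpow hq0.ne']; simp
    · have : q = (q - 2) + 2 := by ring
      rw [this, Real.rpow_add (abs_pos.2 h0), add_sub_cancel_right, Real.rpow_two, sq_abs]
      gcongr
      exact hinf x
  have hs := (summable_sq_of_lp_two u).mul_left ((M * w) ^ (q - 2))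
  have hs' : Summable fun x => |u x| ^ q := hs.of_nonneg_of_le (fun x => by positivity) hterm
  have hle : ∑' x, |u x| ^ q ≤ (M * w ^ (1 - 2 / q)) ^ q := by
    calc ∑' x, |u x| ^ q ≤ ∑' x, (M * w) ^ (q - 2) * u x ^ 2 := hs'.tsum_le_tsum hterm hs
      _ = (M * w) ^ (q - 2) * ‖u‖ ^ 2 := by rw [tsum_mul_left, lp_two_norm_sq]
      _ ≤ (M * w) ^ (q - 2) * M ^ 2 := by gcongr
      _ = (M * w ^ (1 - 2 / q)) ^ q := by
        rw [Real.mul_rpow hM.le hw.le, Real.mul_rpow hM.le (by positivity), ← Real.rpow_mul hw.le,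
          sub_mul, div_mul_cancel₀ _ hq0.ne', one_mul, mul_right_comm, ← Real.rpow_two,
          ← Real.rpow_add hM, sub_add_cancel]
  have hsum : ∑' x, ‖u x‖ₑ ^ q = ENNReal.ofReal (∑' x, |u x| ^ q) := by
    rw [ENNReal.ofReal_tsum_of_nonneg (fun x => by positivity) hs']
    refine tsum_congr fun x => ?_
    rw [← ENNReal.ofReal_rpow_of_nonneg (abs_nonneg _) hq0.le, ← Real.norm_eq_abs, ofReal_norm]
  rw [hsum]
  calc _ ≤ ENNReal.ofReal ((M * w ^ (1 - 2 / q)) ^ q) ^ (1 / q) := by gcongr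
    _ = _ := by
      rw [ENNReal.ofReal_rpow_of_nonneg (by positivity) (by positivity), ← Real.rpow_mul
        (by positivity), mul_one_div_cancel hq0.ne', Real.rpow_one]

/-- global existence and decay for the nonlinear discrete wave equation
on `ℤ⁴` with nonlinearity `F(s) = |s|^{k-1} s`, `k ≥ 4`, for small `l¹` data. -/
theorem nonlinear_global_existence_dim4 (k : ℕ) (hk : 4 ≤ k) :
    ∀ ε : ℝ, 0 < ε → ε < 1 / 2 →
      ∃ δ : ℝ, 0 < δ ∧
        ∀ f : (Fin 4 → ℤ) → ℝ, lpNorm 4 1 f ≤ ENNReal.ofReal δ →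
          ∃ u : (Fin 4 → ℤ) → ℝ → ℝ,
            (∀ (x : Fin 4 → ℤ) (t : ℝ),
              u x t = (∑' y : Fin 4 → ℤ, greenG 4 (x - y) t * f y) +
                ∫ s in (0 : ℝ)..t,
                  ∑' y : Fin 4 → ℤ,
                    greenG 4 (x - y) (t - s) * (|u y s| ^ (k - 1) * u y s)) ∧
            (∀ p : ℝ≥0∞, 2 ≤ p →
              ∃ C : ℝ, 0 < C ∧
                ∀ t : ℝ,
                  lpNorm 4 p (fun x => u x t)
                    ≤ ENNReal.ofReal
                        (C * (1 + |t|) ^ (-(3 / 2 - ε) * (1 - 2 / p.toReal)))) := by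
  intro ε hε hε2
  obtain ⟨m, rfl⟩ : ∃ m, k = m + 2 := ⟨k - 2, by omega⟩
  obtain ⟨C₁, hC₁, hG⟩ := exists_abs_greenG_le (γ := 3 / 2 - ε) (by linarith) (by linarith)
  set C₂ := √(∫ ξ in torusBox 4, (discOmega 4 ξ ^ 2)⁻¹) with hC₂
  have hC₂0 : 0 ≤ C₂ := Real.sqrt_nonneg _
  obtain ⟨δ, M, hδ, hM, hsol⟩ := exists_solution_lpDuhamel (γ := 3 / 2 - ε) (C := C₁ + C₂)
    (by linarith) (by linarith) continuous_lpGreen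
    (fun t => (norm_lpGreen_le t).trans (by linarith))
    (fun t x => (hG x t).trans (mul_le_mul_of_nonneg_right (by linarith)
      (decayWeight_pos _ t).le)) (m := m) (by omega)
  refine ⟨δ, hδ, fun f hf => ?_⟩
  obtain ⟨f', hf', hfn⟩ := exists_lp_one_of_lpNorm_le hδ.le hf
  obtain ⟨u, hu, hduh⟩ := hsol f' hfn
  refine ⟨fun x t => u t x, fun x t => ?_, fun p hp => ⟨M, hM, fun t => ?_⟩⟩
  · have h1 : u t x = lpConv (Fin 4 → ℤ) (lpGreen t) f' x +
        lpDuhamel lpGreen (fun s => lpPower m (u s)) t x := congrArg (fun v => v x) (hduh t)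
    rw [lpDuhamel_apply (h := fun s => lpPower m (u s)) continuous_lpGreen
      ((continuous_lpPower m).comp u.continuous)] at h1
    simp only [lpConv_apply_apply, hf', lpPower_apply] at h1
    exact h1
  · rw [Real.rpow_mul (by positivity)]
    exact lpNorm_le_of_norm_le (u t) hM (decayWeight_pos _ t) (hu t).1 (hu t).2 hp
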